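/- Let ζ be an extremal number. Then w_3(ζ) = 2 + √5 and λ_3(ζ) = 1/√5. -/

import Mathlib

open Polynomial

/-- Height of an integer polynomial: the maximum absolute value of its coefficients. -/
noncomputable def polyH (P : Polynomial ℤ) : ℝ :=
  (((P.support.sup fun i => (P.coeff i).natAbs) : ℕ) : ℝ)

/-- Evaluation of an integer polynomial at a real number. -/
noncomputable def pev (ζ : ℝ) (P : Polynomial ℤ) : ℝ := Polynomial.aeval ζ P

/-- Set of exponents η such that for arbitrarily large X the system
    H(P) ≤ X, 0 < |P(ζ)| ≤ X^(−η) has a solution of degree at most n. -/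
def wSet (n : ℕ) (ζ : ℝ) : Set ℝ :=
  {η | ∀ X₀ : ℝ, ∃ X : ℝ, X₀ ≤ X ∧ ∃ P : Polynomial ℤ,
    P.natDegree ≤ n ∧ polyH P ≤ X ∧ 0 < |pev ζ P| ∧ |pev ζ P| ≤ X ^ (-η)}

/-- The exponent w_n(ζ). -/
noncomputable def wExp (n : ℕ) (ζ : ℝ) : ℝ := sSup (wSet n ζ)

/-- Set of exponents η such that for all sufficiently large X the system
    H(P) ≤ X, 0 < |P(ζ)| ≤ X^(−η) has a solution of degree at most n. -/
def whSet (n : ℕ) (ζ : ℝ) : Set ℝ :=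
  {η | ∃ X₀ : ℝ, ∀ X : ℝ, X₀ ≤ X → ∃ P : Polynomial ℤ,
    P.natDegree ≤ n ∧ polyH P ≤ X ∧ 0 < |pev ζ P| ∧ |pev ζ P| ≤ X ^ (-η)}

/-- The uniform exponent ŵ_n(ζ). -/
noncomputable def whExp (n : ℕ) (ζ : ℝ) : ℝ := sSup (whSet n ζ)

/-- Set of exponents η such that for arbitrarily large X the system
    |x| ≤ X, max_{1≤i≤n} |ζ^i x − y_i| ≤ X^(−η) has a nonzero integer solution. -/
def lamSet (n : ℕ) (ζ : ℝ) : Set ℝ :=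
  {η | ∀ X₀ : ℝ, ∃ X : ℝ, X₀ ≤ X ∧ ∃ x : ℤ, ∃ y : Fin n → ℤ,
    (x ≠ 0 ∨ y ≠ 0) ∧ ((|x| : ℤ) : ℝ) ≤ X ∧
    ∀ i : Fin n, |ζ ^ ((i : ℕ) + 1) * (x : ℝ) - (y i : ℝ)| ≤ X ^ (-η)}

/-- The exponent λ_n(ζ). -/
noncomputable def lamExp (n : ℕ) (ζ : ℝ) : ℝ := sSup (lamSet n ζ)

/-- Set of exponents η such that for all sufficiently large X the system
    |x| ≤ X, max_{1≤i≤n} |ζ^i x − y_i| ≤ X^(−η) has a nonzero integer solution. -/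
def lamhSet (n : ℕ) (ζ : ℝ) : Set ℝ :=
  {η | ∃ X₀ : ℝ, ∀ X : ℝ, X₀ ≤ X → ∃ x : ℤ, ∃ y : Fin n → ℤ,
    (x ≠ 0 ∨ y ≠ 0) ∧ ((|x| : ℤ) : ℝ) ≤ X ∧
    ∀ i : Fin n, |ζ ^ ((i : ℕ) + 1) * (x : ℝ) - (y i : ℝ)| ≤ X ^ (-η)}

/-- The uniform exponent λ̂_n(ζ). -/
noncomputable def lamhExp (n : ℕ) (ζ : ℝ) : ℝ := sSup (lamhSet n ζ)

/-- Set of exponents η such that for arbitrarily large X the polynomial system has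
    at least j linearly independent solutions of degree at most n. -/
def wSetJ (n j : ℕ) (ζ : ℝ) : Set ℝ :=
  {η | ∀ X₀ : ℝ, ∃ X : ℝ, X₀ ≤ X ∧ ∃ P : Fin j → Polynomial ℤ,
    LinearIndependent ℤ P ∧ ∀ i : Fin j,
      (P i).natDegree ≤ n ∧ polyH (P i) ≤ X ∧ 0 < |pev ζ (P i)| ∧ |pev ζ (P i)| ≤ X ^ (-η)}

/-- The exponent w_{n,j}(ζ). -/
noncomputable def wExpJ (n j : ℕ) (ζ : ℝ) : ℝ := sSup (wSetJ n j ζ)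

/-- Set of exponents η such that for all sufficiently large X the polynomial system has
    at least j linearly independent solutions of degree at most n. -/
def whSetJ (n j : ℕ) (ζ : ℝ) : Set ℝ :=
  {η | ∃ X₀ : ℝ, ∀ X : ℝ, X₀ ≤ X → ∃ P : Fin j → Polynomial ℤ,
    LinearIndependent ℤ P ∧ ∀ i : Fin j,
      (P i).natDegree ≤ n ∧ polyH (P i) ≤ X ∧ 0 < |pev ζ (P i)| ∧ |pev ζ (P i)| ≤ X ^ (-η)}

/-- The uniform exponent ŵ_{n,j}(ζ). -/
noncomputable def whExpJ (n j : ℕ) (ζ : ℝ) : ℝ := sSup (whSetJ n j ζ)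

/-- Set of exponents η such that for arbitrarily large X the simultaneous approximation
    system has at least j linearly independent integer vector solutions. -/
def lamSetJ (n j : ℕ) (ζ : ℝ) : Set ℝ :=
  {η | ∀ X₀ : ℝ, ∃ X : ℝ, X₀ ≤ X ∧ ∃ v : Fin j → (Fin (n + 1) → ℤ),
    LinearIndependent ℤ v ∧ ∀ i : Fin j,
      ((|v i 0| : ℤ) : ℝ) ≤ X ∧
      ∀ t : Fin n, |ζ ^ ((t : ℕ) + 1) * ((v i 0 : ℤ) : ℝ) - ((v i t.succ : ℤ) : ℝ)| ≤ X ^ (-η)}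

/-- The exponent λ_{n,j}(ζ). -/
noncomputable def lamExpJ (n j : ℕ) (ζ : ℝ) : ℝ := sSup (lamSetJ n j ζ)

/-- Set of exponents η such that for all sufficiently large X the simultaneous approximation
    system has at least j linearly independent integer vector solutions. -/
def lamhSetJ (n j : ℕ) (ζ : ℝ) : Set ℝ :=
  {η | ∃ X₀ : ℝ, ∀ X : ℝ, X₀ ≤ X → ∃ v : Fin j → (Fin (n + 1) → ℤ),
    LinearIndependent ℤ v ∧ ∀ i : Fin j,
      ((|v i 0| : ℤ) : ℝ) ≤ X ∧
      ∀ t : Fin n, |ζ ^ ((t : ℕ) + 1) * ((v i 0 : ℤ) : ℝ) - ((v i t.succ : ℤ) : ℝ)| ≤ X ^ (-η)}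

/-- The uniform exponent λ̂_{n,j}(ζ). -/
noncomputable def lamhExpJ (n j : ℕ) (ζ : ℝ) : ℝ := sSup (lamhSetJ n j ζ)

/-- An extremal number: a real transcendental number with ŵ₂(ζ) = (3+√5)/2. -/
def IsExtremal (ζ : ℝ) : Prop :=
  Transcendental ℚ ζ ∧ whExp 2 ζ = (3 + Real.sqrt 5) / 2

namespace ExtremalCubic

/-- The integer vector `v` viewed as a real vector. -/
abbrev castVec {n : ℕ} (v : Fin n → ℤ) : Fin n → ℝ := fun i => (v i : ℝ)

/-- The cross product of two vectors of length three. -/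
def cross {R : Type*} [CommRing R] (a b : Fin 3 → R) : Fin 3 → R :=
  ![a 1 * b 2 - a 2 * b 1, a 2 * b 0 - a 0 * b 2, a 0 * b 1 - a 1 * b 0]

/-- The determinant with rows `a`, `b`, `c`. -/
def det3 {R : Type*} [CommRing R] (a b c : Fin 3 → R) : R :=
  (a 1 * b 2 - a 2 * b 1) * c 0 + (a 2 * b 0 - a 0 * b 2) * c 1 + (a 0 * b 1 - a 1 * b 0) * c 2

/-- The determinant with rows `a`, `b`, `c`, `d`. -/
def det4 {R : Type*} [CommRing R] (a b c d : Fin 4 → R) : R :=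
  a 0 * det3 ![b 1, b 2, b 3] ![c 1, c 2, c 3] ![d 1, d 2, d 3]
    - b 0 * det3 ![a 1, a 2, a 3] ![c 1, c 2, c 3] ![d 1, d 2, d 3]
    + c 0 * det3 ![a 1, a 2, a 3] ![b 1, b 2, b 3] ![d 1, d 2, d 3]
    - d 0 * det3 ![a 1, a 2, a 3] ![b 1, b 2, b 3] ![c 1, c 2, c 3]

/-- The polynomial of degree at most two with coefficient vector `v`, evaluated at `ζ`. -/
def ev3 (ζ : ℝ) (v : Fin 3 → ℝ) : ℝ := v 0 + v 1 * ζ + v 2 * ζ ^ 2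

/-- The polynomial of degree at most three with coefficient vector `v`, evaluated at `ζ`. -/
def ev4 (ζ : ℝ) (v : Fin 4 → ℝ) : ℝ := v 0 + v 1 * ζ + v 2 * ζ ^ 2 + v 3 * ζ ^ 3

/-- A quadratic polynomial viewed as a cubic one. -/
def low {R : Type*} [CommRing R] (v : Fin 3 → R) : Fin 4 → R := ![v 0, v 1, v 2, 0]

/-- A quadratic polynomial multiplied by the variable. -/
def high {R : Type*} [CommRing R] (v : Fin 3 → R) : Fin 4 → R := ![0, v 0, v 1, v 2]

/-- The resultant of two quadratic polynomials. -/
def res {R : Type*} [CommRing R] (a b : Fin 3 → R) : R := det4 (low a) (high a) (low b) (high b)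

section Algebra

variable {R : Type*} [CommRing R]

lemma res_eq_cross (a b : Fin 3 → R) :
    res a b = cross a b 1 ^ 2 - cross a b 0 * cross a b 2 := by
  simp [res, det4, det3, low, high, cross]
  ring

lemma det3_eq_cross (a b c : Fin 3 → R) :
    det3 a b c = cross a b 0 * c 0 + cross a b 1 * c 1 + cross a b 2 * c 2 := by
  simp [det3, cross]

lemma det4_cramer (a b c d y : Fin 4 → R) (i : Fin 4) :
    det4 a b c d * y i = det4 y b c d * a i + det4 a y c d * b i + det4 a b y d * c i
      + det4 a b c y * d i := by
  fin_cases i <;> simp [det4, det3] <;> ring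

lemma det4_add_smul_snd (w a b c d r s : Fin 4 → R) (k l m n : R) :
    det4 w (fun i => k * a i + l * b i + m * c i + n * d i) r s
      = k * det4 w a r s + l * det4 w b r s + m * det4 w c r s + n * det4 w d r s := by
  simp [det4, det3]; ring

/-- Two cross products of vectors from a common plane are parallel. -/
lemma cross_parallel {a b c d : Fin 3 → R} (hc : det3 a b c = 0) (hd : det3 a b d = 0)
    (i j : Fin 3) : cross a b i * cross c d j = cross a b j * cross c d i := by
  simp only [det3] at hc hd
  fin_cases i <;> fin_cases j <;> simp [cross]
  · linear_combination c 2 * hd - d 2 * hc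
  · linear_combination d 1 * hc - c 1 * hd
  · linear_combination d 2 * hc - c 2 * hd
  · linear_combination c 0 * hd - d 0 * hc
  · linear_combination c 1 * hd - d 1 * hc
  · linear_combination d 0 * hc - c 0 * hd

end Algebra

lemma det3_ne_zero_of_plane {a b c d e : Fin 3 → ℤ} (hc : det3 a b c = 0) (hd : det3 a b d = 0)
    (hcd : cross c d ≠ 0) (he : det3 a b e ≠ 0) : det3 c d e ≠ 0 := by
  intro h
  apply hcd
  funext i
  have key : cross c d i * det3 a b e = cross a b i * det3 c d e := by
    rw [det3_eq_cross, det3_eq_cross]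
    have h0 := cross_parallel hc hd i 0
    have h1 := cross_parallel hc hd i 1
    have h2 := cross_parallel hc hd i 2
    linear_combination -(e 0 * h0 + e 1 * h1 + e 2 * h2)
  rw [h, mul_zero] at key
  exact (mul_eq_zero.mp key).resolve_right he

/-- Parallel integer vectors are multiples of a common integer vector. -/
lemma exists_common_divisor {n : ℕ} {a b : Fin n → ℤ} (ha : a ≠ 0)
    (hb : b ≠ 0) (h : ∀ i j, a i * b j = a j * b i) :
    ∃ (z : Fin n → ℤ) (k l : ℤ), k ≠ 0 ∧ l ≠ 0 ∧ (∀ i, a i = k * z i) ∧ ∀ i, b i = l * z i := by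
  obtain ⟨i₀, hi₀⟩ := Function.ne_iff.mp ha
  obtain ⟨z, hz, hg⟩ := Finset.extract_gcd (s := Finset.univ) a ⟨i₀, Finset.mem_univ _⟩
  obtain ⟨u, hu⟩ := Finset.gcd_eq_sum_mul Finset.univ z
  set k := Finset.univ.gcd a
  have hk : k ≠ 0 := fun h => hi₀ (by simp [hz i₀ (Finset.mem_univ _), h])
  have hz' : ∀ i, a i = k * z i := fun i => hz i (Finset.mem_univ _)
  have hzb : ∀ i, b i = (∑ j, b j * u j) * z i := by
    intro i
    have hu' : ∑ j, z j * u j = 1 := by rw [← hg, hu]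
    have : ∀ j, b j * z i = b i * z j := by
      intro j
      apply mul_left_cancel₀ hk
      have := h i j
      rw [hz', hz'] at this
      linear_combination this
    calc b i = b i * ∑ j, z j * u j := by rw [hu', mul_one]
      _ = ∑ j, (b i * z j) * u j := by rw [Finset.mul_sum]; simp only [mul_assoc]
      _ = _ := by
        rw [Finset.sum_mul]
        refine Finset.sum_congr rfl fun j _ => ?_
        rw [← this]; ring
  refine ⟨z, k, ∑ j, b j * u j, hk, fun h0 => hb ?_, hz', hzb⟩
  funext i
  rw [hzb i, h0, zero_mul]; rfl

lemma abs_le_of_mul_eq {k x y : ℤ} (hk : k ≠ 0) (h : y = k * x) : |(x : ℝ)| ≤ |(y : ℝ)| := by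
  have : |x| ≤ |y| := by
    rw [h, abs_mul]
    exact le_mul_of_one_le_left (abs_nonneg _) (Int.one_le_abs hk)
  exact_mod_cast this

lemma one_le_abs_cast {x : ℤ} (hx : x ≠ 0) : (1 : ℝ) ≤ |(x : ℝ)| := by
  exact_mod_cast Int.one_le_abs hx

section Estimates

variable {ζ : ℝ}

lemma det3_cast (a b c : Fin 3 → ℤ) :
    ((det3 a b c : ℤ) : ℝ) = det3 (castVec a) (castVec b) (castVec c) := by
  simp [det3]

lemma det4_cast (a b c d : Fin 4 → ℤ) :
    ((det4 a b c d : ℤ) : ℝ) = det4 (castVec a) (castVec b) (castVec c) (castVec d) := by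
  simp [det4, det3]

lemma abs_minor_le {x y z t X Y : ℝ} (hx : |x| ≤ X) (hy : |y| ≤ Y) (hz : |z| ≤ X) (ht : |t| ≤ Y) :
    |x * y - z * t| ≤ 2 * (X * Y) := by
  have h1 : |x * y| ≤ X * Y := by
    rw [abs_mul]; exact mul_le_mul hx hy (abs_nonneg _) ((abs_nonneg _).trans hx)
  have h2 : |z * t| ≤ X * Y := by
    rw [abs_mul]; exact mul_le_mul hz ht (abs_nonneg _) ((abs_nonneg _).trans hz)
  linarith [abs_sub (x * y) (z * t)]

lemma abs_det3_le_of_coeff {a b c : Fin 3 → ℝ} {A B C : ℝ} (ha : ∀ i, |a i| ≤ A)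
    (hb : ∀ i, |b i| ≤ B) (hc : ∀ i, |c i| ≤ C) : |det3 a b c| ≤ 6 * (A * B * C) := by
  have hA := (abs_nonneg _).trans (ha 0)
  have hB := (abs_nonneg _).trans (hb 0)
  have key : ∀ i j k : Fin 3, |(a i * b j - a j * b i) * c k| ≤ 2 * (A * B) * C := by
    intro i j k
    rw [abs_mul]
    refine mul_le_mul ?_ (hc k) (abs_nonneg _) (by positivity)
    exact abs_minor_le (ha i) (hb j) (ha j) (hb i)
  unfold det3
  refine (abs_add_three _ _ _).trans ?_
  linarith [key 1 2 0, key 2 0 1, key 0 1 2]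

lemma abs_det3_le (ζ : ℝ) {a b c : Fin 3 → ℝ} {A B C : ℝ} (ha : ∀ i, |a i| ≤ A)
    (hb : ∀ i, |b i| ≤ B) (hc : ∀ i, |c i| ≤ C) :
    |det3 a b c| ≤ 2 * (|ev3 ζ a| * (B * C) + |ev3 ζ b| * (A * C) + |ev3 ζ c| * (A * B)) := by
  have e : det3 a b c = ev3 ζ a * (b 1 * c 2 - b 2 * c 1) - ev3 ζ b * (a 1 * c 2 - a 2 * c 1)
      + ev3 ζ c * (a 1 * b 2 - a 2 * b 1) := by
    simp only [det3, ev3]; ring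
  rw [e]
  have h1 := mul_le_mul_of_nonneg_left (abs_minor_le (hb 1) (hc 2) (hb 2) (hc 1))
    (abs_nonneg (ev3 ζ a))
  have h2 := mul_le_mul_of_nonneg_left (abs_minor_le (ha 1) (hc 2) (ha 2) (hc 1))
    (abs_nonneg (ev3 ζ b))
  have h3 := mul_le_mul_of_nonneg_left (abs_minor_le (ha 1) (hb 2) (ha 2) (hb 1))
    (abs_nonneg (ev3 ζ c))
  rw [← abs_mul] at h1 h2 h3
  refine (abs_add_le _ _).trans ?_
  have := abs_sub (ev3 ζ a * (b 1 * c 2 - b 2 * c 1)) (ev3 ζ b * (a 1 * c 2 - a 2 * c 1))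
  linarith

lemma abs_det4_le (ζ : ℝ) {a b c d : Fin 4 → ℝ} {A B C D : ℝ} (ha : ∀ i, |a i| ≤ A)
    (hb : ∀ i, |b i| ≤ B) (hc : ∀ i, |c i| ≤ C) (hd : ∀ i, |d i| ≤ D) :
    |det4 a b c d| ≤ 6 * (|ev4 ζ a| * (B * C * D) + |ev4 ζ b| * (A * C * D)
      + |ev4 ζ c| * (A * B * D) + |ev4 ζ d| * (A * B * C)) := by
  have e : det4 a b c d =
      ev4 ζ a * det3 ![b 1, b 2, b 3] ![c 1, c 2, c 3] ![d 1, d 2, d 3]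
      - ev4 ζ b * det3 ![a 1, a 2, a 3] ![c 1, c 2, c 3] ![d 1, d 2, d 3]
      + ev4 ζ c * det3 ![a 1, a 2, a 3] ![b 1, b 2, b 3] ![d 1, d 2, d 3]
      - ev4 ζ d * det3 ![a 1, a 2, a 3] ![b 1, b 2, b 3] ![c 1, c 2, c 3] := by
    simp [det4, det3, ev4]; ring
  have t : ∀ {v : Fin 4 → ℝ} {V : ℝ}, (∀ i, |v i| ≤ V) → ∀ i, |![v 1, v 2, v 3] i| ≤ V := by
    intro v V h i
    fin_cases i
    · exact h 1
    · exact h 2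
    · exact h 3
  have h1 := mul_le_mul_of_nonneg_left (abs_det3_le_of_coeff (t hb) (t hc) (t hd))
    (abs_nonneg (ev4 ζ a))
  have h2 := mul_le_mul_of_nonneg_left (abs_det3_le_of_coeff (t ha) (t hc) (t hd))
    (abs_nonneg (ev4 ζ b))
  have h3 := mul_le_mul_of_nonneg_left (abs_det3_le_of_coeff (t ha) (t hb) (t hd))
    (abs_nonneg (ev4 ζ c))
  have h4 := mul_le_mul_of_nonneg_left (abs_det3_le_of_coeff (t ha) (t hb) (t hc))
    (abs_nonneg (ev4 ζ d))
  rw [← abs_mul] at h1 h2 h3 h4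
  rw [e]
  refine (abs_sub _ _).trans ?_
  have s1 := abs_add_le (ev4 ζ a * det3 ![b 1, b 2, b 3] ![c 1, c 2, c 3] ![d 1, d 2, d 3]
      - ev4 ζ b * det3 ![a 1, a 2, a 3] ![c 1, c 2, c 3] ![d 1, d 2, d 3])
      (ev4 ζ c * det3 ![a 1, a 2, a 3] ![b 1, b 2, b 3] ![d 1, d 2, d 3])
  have s2 := abs_sub (ev4 ζ a * det3 ![b 1, b 2, b 3] ![c 1, c 2, c 3] ![d 1, d 2, d 3])
      (ev4 ζ b * det3 ![a 1, a 2, a 3] ![c 1, c 2, c 3] ![d 1, d 2, d 3])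
  linarith

end Estimates

/-- The absolute value at `ζ` of the quadratic polynomial with coefficient vector `v`. -/
abbrev absEv (ζ : ℝ) (v : Fin 3 → ℤ) : ℝ := |ev3 ζ (castVec v)|

/-- A sequence of quadratic integer polynomials, the `n`-th one having the smallest absolute value
at `ζ` among the nonzero ones with coefficients bounded by `n + 1`. -/
structure IsMinimalSeq (ζ : ℝ) (P : ℕ → Fin 3 → ℤ) : Prop where
  ne_zero : ∀ n : ℕ, P n ≠ 0
  coeff_le : ∀ (n : ℕ) (i : Fin 3), |(P n i : ℝ)| ≤ n + 1
  le_of_coeff_le : ∀ (n : ℕ) (v : Fin 3 → ℤ), v ≠ 0 → (∀ i, |(v i : ℝ)| ≤ n + 1) →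
    absEv ζ (P n) ≤ absEv ζ v

lemma ev4_low (ζ : ℝ) (v : Fin 3 → ℝ) : ev4 ζ (low v) = ev3 ζ v := by
  simp [ev3, ev4, low]

lemma ev4_high (ζ : ℝ) (v : Fin 3 → ℝ) : ev4 ζ (high v) = ζ * ev3 ζ v := by
  simp [ev3, ev4, high]; ring

lemma castVec_low (v : Fin 3 → ℤ) : castVec (low v) = low (castVec v) := by
  funext i; fin_cases i <;> simp [low, castVec]

lemma castVec_high (v : Fin 3 → ℤ) : castVec (high v) = high (castVec v) := by
  funext i; fin_cases i <;> simp [high, castVec]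

lemma ev4_ne_zero {ζ : ℝ} (hζ : Transcendental ℚ ζ) {v : Fin 4 → ℤ} (hv : v ≠ 0) :
    ev4 ζ (castVec v) ≠ 0 := by
  intro h
  apply hv
  set p : ℚ[X] := C (v 0 : ℚ) + C (v 1 : ℚ) * X + C (v 2 : ℚ) * X ^ 2 + C (v 3 : ℚ) * X ^ 3 with hp
  have h0 : p = 0 := by
    refine (transcendental_iff.mp hζ) p ?_
    simp [hp]
    simpa [ev4] using h
  have hc : ∀ n, p.coeff n = 0 := fun n => by rw [h0]; simp
  funext i
  have c0 := hc 0
  have c1 := hc 1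
  have c2 := hc 2
  have c3 := hc 3
  simp [hp, coeff_X, coeff_C, -map_intCast, -eq_intCast] at c0 c1 c2 c3
  fin_cases i
  · exact c0
  · exact c1
  · exact c2
  · exact c3

lemma low_ne_zero {v : Fin 3 → ℤ} (hv : v ≠ 0) : low v ≠ 0 := by
  intro h
  apply hv
  funext i
  fin_cases i
  · exact congrFun h 0
  · exact congrFun h 1
  · exact congrFun h 2

lemma ev3_ne_zero {ζ : ℝ} (hζ : Transcendental ℚ ζ) {v : Fin 3 → ℤ} (hv : v ≠ 0) :
    ev3 ζ (castVec v) ≠ 0 := by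
  rw [← ev4_low, ← castVec_low]
  exact ev4_ne_zero hζ (low_ne_zero hv)

lemma eq_or_eq_neg_of_abs_ev3_eq {ζ : ℝ} (hζ : Transcendental ℚ ζ) {u v : Fin 3 → ℤ}
    (h : absEv ζ u = absEv ζ v) : u = v ∨ u = -v := by
  rcases abs_eq_abs.mp h with h | h
  · left
    by_contra hne
    refine ev3_ne_zero hζ (sub_ne_zero.mpr hne) ?_
    simp [ev3, castVec] at h ⊢; linarith
  · right
    by_contra hne
    refine ev3_ne_zero hζ (v := u + v) (fun h0 => hne (eq_neg_of_add_eq_zero_left h0)) ?_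
    simp [ev3, castVec] at h ⊢; linarith

lemma det3_eq_zero_of_absEv_eq {ζ : ℝ} (hζ : Transcendental ℚ ζ) {a b u v : Fin 3 → ℤ}
    (h : absEv ζ u = absEv ζ v) (hv : det3 a b v = 0) : det3 a b u = 0 := by
  rcases eq_or_eq_neg_of_abs_ev3_eq hζ h with h | h
  · rwa [h]
  · have : det3 a b (-v) = -det3 a b v := by simp [det3]; ring
    rw [h, this, hv, neg_zero]

lemma exists_isMinimalSeq (ζ : ℝ) : ∃ P, IsMinimalSeq ζ P := by
  have key : ∀ n : ℕ, ∃ p : Fin 3 → ℤ, p ≠ 0 ∧ (∀ i, |(p i : ℝ)| ≤ n + 1) ∧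
      ∀ v : Fin 3 → ℤ, v ≠ 0 → (∀ i, |(v i : ℝ)| ≤ n + 1) →
        absEv ζ p ≤ absEv ζ v := by
    intro n
    have hfin : {v : Fin 3 → ℤ | v ≠ 0 ∧ ∀ i, |(v i : ℝ)| ≤ n + 1}.Finite := by
      refine (Set.finite_Icc (fun _ : Fin 3 => (-(n + 1) : ℤ)) (fun _ => (n + 1 : ℤ))).subset ?_
      rintro v ⟨-, hv⟩
      have hv' : ∀ i, |v i| ≤ (n + 1 : ℤ) := fun i => by exact_mod_cast hv i
      exact ⟨fun i => (abs_le.mp (hv' i)).1, fun i => (abs_le.mp (hv' i)).2⟩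
    obtain ⟨p, hp, hmin⟩ := Set.exists_min_image _ (absEv ζ) hfin
      ⟨fun _ => 1, fun h => by simpa using congrFun h 0, fun i => by simp⟩
    exact ⟨p, hp.1, hp.2, fun v h0 hv => hmin v ⟨h0, hv⟩⟩
  choose P h1 h2 h3 using key
  exact ⟨P, h1, h2, h3⟩

namespace IsMinimalSeq

variable {ζ : ℝ} {P : ℕ → Fin 3 → ℤ}

lemma antitone (hP : IsMinimalSeq ζ P) : Antitone fun n => absEv ζ (P n) := by
  intro m n hmn
  refine hP.le_of_coeff_le n _ (hP.ne_zero m) fun i => (hP.coeff_le m i).trans ?_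
  have : (m : ℝ) ≤ n := by exact_mod_cast hmn
  linarith

lemma cross_ne_zero (hP : IsMinimalSeq ζ P) {m n : ℕ}
    (h : absEv ζ (P n) < absEv ζ (P m)) : cross (P m) (P n) ≠ 0 := by
  intro h0
  have c0 := congrFun h0 0
  have c1 := congrFun h0 1
  have c2 := congrFun h0 2
  simp [cross] at c0 c1 c2
  obtain ⟨z, k, l, hk, hl, h1, h2⟩ := exists_common_divisor (hP.ne_zero m) (hP.ne_zero n) (by
    intro i j
    fin_cases i <;> fin_cases j <;> simp <;> linarith)
  have hz : z ≠ 0 := fun h => hP.ne_zero m (by funext i; simp [h1, h])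
  have := hP.le_of_coeff_le m z hz fun i => (abs_le_of_mul_eq hk (h1 i)).trans (hP.coeff_le m i)
  have e : ev3 ζ (castVec (P n)) = l * ev3 ζ (castVec z) := by
    simp [ev3, castVec, h2]; ring
  rw [absEv, e, abs_mul] at h
  have := mul_le_mul_of_nonneg_right (one_le_abs_cast hl) (abs_nonneg (ev3 ζ (castVec z)))
  linarith

/-- From a minimal polynomial followed by a better one, pass to the last pair of consecutive
minimal polynomials spanning the same plane. -/
lemma exists_next (hP : IsMinimalSeq ζ P) (hζ : Transcendental ℚ ζ) {m : ℕ}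
    (hm : absEv ζ (P (m + 1)) < absEv ζ (P m))
    (hex : ∃ j, m ≤ j ∧ det3 (P m) (P (m + 1)) (P (j + 1)) ≠ 0) :
    ∃ l j, m ≤ l ∧ l < j ∧ absEv ζ (P (l + 1)) < absEv ζ (P l) ∧
      absEv ζ (P (j + 1)) < absEv ζ (P j) ∧
      absEv ζ (P (l + 1)) = absEv ζ (P j) ∧
      det3 (P m) (P (m + 1)) (P l) = 0 ∧ det3 (P m) (P (m + 1)) (P (l + 1)) = 0 ∧
      det3 (P l) (P (l + 1)) (P (j + 1)) ≠ 0 := by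
  classical
  obtain ⟨hmj, hj⟩ := Nat.find_spec hex
  have hmin : ∀ i, m ≤ i → i < Nat.find hex → det3 (P m) (P (m + 1)) (P (i + 1)) = 0 :=
    fun i hi hlt => by
      have := Nat.find_min hex hlt
      push Not at this
      exact this hi
  set j := Nat.find hex
  have hmj' : m < j := by
    rcases hmj.lt_or_eq with h | h
    · exact h
    · rw [← h] at hj
      exact absurd (by simp [det3]; ring) hj
  have hV : ∀ i, m ≤ i → i ≤ j → det3 (P m) (P (m + 1)) (P i) = 0 := by
    intro i hi hij
    rcases hi.lt_or_eq with h | h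
    · obtain ⟨i, rfl⟩ : ∃ i', i = i' + 1 := ⟨i - 1, by omega⟩
      exact hmin i (by omega) (by omega)
    · rw [← h]; simp [det3]; ring
  have hanti := hP.antitone
  have hdj : absEv ζ (P (j + 1)) < absEv ζ (P j) := by
    refine lt_of_le_of_ne (hanti (Nat.le_succ j)) fun h => hj ?_
    exact det3_eq_zero_of_absEv_eq hζ h (hV j hmj le_rfl)
  have hexl : ∃ l, absEv ζ (P (l + 1)) ≤ absEv ζ (P j) :=
    ⟨j - 1, by rw [Nat.sub_add_cancel (by omega)]⟩
  have hl := Nat.find_spec hexl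
  have hlj : Nat.find hexl ≤ j - 1 := Nat.find_min' hexl (by rw [Nat.sub_add_cancel (by omega)])
  have hlmin : ∀ i, i < Nat.find hexl → absEv ζ (P j) < absEv ζ (P (i + 1)) :=
    fun i hi => not_le.mp (Nat.find_min hexl hi)
  set l := Nat.find hexl
  have hml : m ≤ l := by
    by_contra! h
    have h1 : absEv ζ (P m) ≤ absEv ζ (P (l + 1)) := hanti h
    have h2 : absEv ζ (P j) ≤ absEv ζ (P (m + 1)) := hanti hmj'
    linarith
  have hdl : absEv ζ (P (l + 1)) < absEv ζ (P l) := by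
    rcases hml.lt_or_eq with h | h
    · have := hlmin (l - 1) (by omega)
      rw [Nat.sub_add_cancel (by omega)] at this
      linarith
    · rw [← h]; exact hm
  have hPl := hV l hml (by omega)
  have hPl' := hV (l + 1) (by omega) (by omega)
  exact ⟨l, j, hml, by omega, hdl, hdj, le_antisymm hl (hanti (by omega)), hPl, hPl',
    det3_ne_zero_of_plane hPl hPl' (hP.cross_ne_zero hdl) hj⟩

end IsMinimalSeq

lemma abs_mul_cross_sub_le {ζ : ℝ} {a b : Fin 3 → ℝ} {A B : ℝ} (ha : ∀ i, |a i| ≤ A)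
    (hb : ∀ i, |b i| ≤ B) :
    |ζ * cross a b 0 - cross a b 1| ≤ 2 * (1 + |ζ|) * (|ev3 ζ a| * B + |ev3 ζ b| * A) ∧
    |ζ * cross a b 1 - cross a b 2| ≤ 2 * (1 + |ζ|) * (|ev3 ζ a| * B + |ev3 ζ b| * A) := by
  have hz := abs_nonneg ζ
  constructor
  · have := abs_det3_le ζ ha hb (c := ![ζ, -1, 0]) (C := 1 + |ζ|) (by
      intro i; fin_cases i <;> simp; linarith)
    have e0 : ev3 ζ ![ζ, -1, 0] = 0 := by simp [ev3]
    have e1 : det3 a b ![ζ, -1, 0] = ζ * cross a b 0 - cross a b 1 := by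
      simp [det3, cross]; ring
    rw [e0, e1, abs_zero] at this
    linarith
  · have := abs_det3_le ζ ha hb (c := ![0, ζ, -1]) (C := 1 + |ζ|) (by
      intro i; fin_cases i <;> simp; linarith)
    have e0 : ev3 ζ ![0, ζ, -1] = 0 := by simp [ev3]; ring
    have e1 : det3 a b ![0, ζ, -1] = ζ * cross a b 1 - cross a b 2 := by
      simp [det3, cross]; ring
    rw [e0, e1, abs_zero] at this
    linarith

lemma abs_cross_le {a b : Fin 3 → ℝ} {A B : ℝ} (ha : ∀ i, |a i| ≤ A)
    (hb : ∀ i, |b i| ≤ B) (i : Fin 3) : |cross a b i| ≤ 2 * (A * B) := by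
  fin_cases i
  · exact abs_minor_le (ha 1) (hb 2) (ha 2) (hb 1)
  · exact abs_minor_le (ha 2) (hb 0) (ha 0) (hb 2)
  · exact abs_minor_le (ha 0) (hb 1) (ha 1) (hb 0)

lemma castVec_cross (a b : Fin 3 → ℤ) : castVec (cross a b) = cross (castVec a) (castVec b) := by
  funext i; fin_cases i <;> simp [cross, castVec]

lemma abs_sq_sub_mul_le {ζ Z L : ℝ} {z : Fin 3 → ℝ} (hz : ∀ i, |z i| ≤ Z)
    (h0 : |ζ * z 0 - z 1| ≤ L) (h1 : |ζ * z 1 - z 2| ≤ L) :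
    |z 1 ^ 2 - z 0 * z 2| ≤ 2 * (Z * L) := by
  have e : z 1 ^ 2 - z 0 * z 2 = z 0 * (ζ * z 1 - z 2) - z 1 * (ζ * z 0 - z 1) := by ring
  rw [e]
  exact abs_minor_le (hz 0) h1 (hz 1) h0

lemma abs_mul_sub_le_of_eq_mul {ζ : ℝ} {b z : Fin 3 → ℤ} {l : ℤ} (hl : l ≠ 0)
    (h : ∀ i, b i = l * z i) (i j : Fin 3) :
    |ζ * z i - z j| ≤ |ζ * (castVec b) i - (castVec b) j| := by
  have : ζ * (castVec b) i - (castVec b) j = l * (ζ * z i - z j) := by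
    change ζ * (b i : ℝ) - b j = _
    rw [h, h]; push_cast; ring
  rw [this, abs_mul]
  exact le_mul_of_one_le_left (abs_nonneg _) (one_le_abs_cast hl)

/-- If the integer point `z` lies on the conic `z 1 ^ 2 = z 0 * z 2` and on the line defined by
`q`, then the value of `p` at the corresponding rational point is bounded below. -/
lemma one_le_of_conic {ζ H L : ℝ} {p q z : Fin 3 → ℤ} (hp : ∀ i, |(p i : ℝ)| ≤ H)
    (hq : ∀ i, |(q i : ℝ)| ≤ H) (hq0 : q ≠ 0) (hz : z 1 ^ 2 = z 0 * z 2) (hz0 : z ≠ 0)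
    (hqz : q 0 * z 0 + q 1 * z 1 + q 2 * z 2 = 0) (hpz : p 0 * z 0 + p 1 * z 1 + p 2 * z 2 ≠ 0)
    (h0 : |ζ * z 0 - z 1| ≤ L) (h1 : |ζ * z 1 - z 2| ≤ L) (hL : L < 1) :
    1 ≤ H ^ 2 * |ev3 ζ (castVec p)| + (2 + 2 * |ζ|) * (H * L) := by
  have hH : 0 ≤ H := (abs_nonneg _).trans (hp 0)
  have hz00 : z 0 ≠ 0 := by
    intro h
    have hz1 : z 1 = 0 := by simpa [h] using hz
    have hz2 : z 2 = 0 := by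
      by_contra hne
      have := one_le_abs_cast hne
      rw [hz1] at h1
      simp at h1
      linarith
    exact hz0 (by funext i; fin_cases i <;> assumption)
  obtain ⟨g, r, s, hg, hr, hs, hco⟩ : ∃ g r s : ℤ, g ≠ 0 ∧ z 0 = g * r ∧ z 1 = g * s ∧
      IsCoprime r s := by
    have hgpos : 0 < Int.gcd (z 0) (z 1) := Int.gcd_pos_of_ne_zero_left _ hz00
    obtain ⟨r, s, hco, hr, hs⟩ := Int.exists_gcd_one hgpos
    exact ⟨Int.gcd (z 0) (z 1), r, s, by exact_mod_cast hgpos.ne', hr.trans (mul_comm _ _),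
      hs.trans (mul_comm _ _), Int.isCoprime_iff_gcd_eq_one.mpr hco⟩
  have hr0 : r ≠ 0 := fun h => hz00 (by rw [hr, h, mul_zero])
  have h2 : g * s ^ 2 = r * z 2 := by
    apply mul_left_cancel₀ hg
    rw [hr, hs] at hz
    linear_combination hz
  obtain ⟨g', rfl⟩ : r ∣ g :=
    (hco.pow_right (n := 2)).dvd_of_dvd_mul_right ⟨z 2, h2⟩
  have hz2 : z 2 = g' * s ^ 2 := by
    apply mul_left_cancel₀ hr0
    linear_combination -h2
  have hg' : g' ≠ 0 := fun h => hg (by rw [h, mul_zero])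
  have hqr : q 0 * r ^ 2 + q 1 * (r * s) + q 2 * s ^ 2 = 0 := by
    apply mul_left_cancel₀ hg'
    rw [hr, hs, hz2] at hqz
    linear_combination hqz
  have hpr : p 0 * r ^ 2 + p 1 * (r * s) + p 2 * s ^ 2 ≠ 0 := by
    intro h
    apply hpz
    rw [hr, hs, hz2]
    linear_combination g' * h
  have hrH : |(r : ℝ)| ≤ H := by
    have hbound : ∀ x : ℤ, x ≠ 0 → r ∣ x → |(x : ℝ)| ≤ H → |(r : ℝ)| ≤ H := by
      rintro x hx ⟨y, rfl⟩ hxH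
      refine (abs_le_of_mul_eq (k := y) (fun h => hx (by rw [h, mul_zero])) (mul_comm r y)).trans
        hxH
    by_cases hq2 : q 2 = 0
    · have h : q 0 * r + q 1 * s = 0 := by
        apply mul_left_cancel₀ hr0
        rw [hq2] at hqr
        linear_combination hqr
      have hd : r ∣ q 1 := hco.dvd_of_dvd_mul_right ⟨-q 0, by linear_combination h⟩
      refine hbound _ (fun hq1 => hq0 ?_) hd (hq 1)
      have hq00 : q 0 = 0 := by
        rw [hq1, zero_mul, add_zero] at h
        exact (mul_eq_zero.mp h).resolve_right hr0
      funext i; fin_cases i <;> assumption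
    · have hd : r ∣ q 2 := (hco.pow_right (n := 2)).dvd_of_dvd_mul_right
        ⟨-(q 0 * r + q 1 * s), by linear_combination hqr⟩
      exact hbound _ hq2 hd (hq 2)
  have hd0 : |ζ * r ^ 2 - r * s| ≤ L := by
    refine le_trans ?_ h0
    have : ζ * z 0 - z 1 = g' * (ζ * r ^ 2 - r * s) := by rw [hr, hs]; push_cast; ring
    rw [this, abs_mul]
    exact le_mul_of_one_le_left (abs_nonneg _) (one_le_abs_cast hg')
  have hd1 : |ζ * (r * s) - s ^ 2| ≤ L := by
    refine le_trans ?_ h1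
    have : ζ * z 1 - z 2 = g' * (ζ * (r * s) - s ^ 2) := by rw [hs, hz2]; push_cast; ring
    rw [this, abs_mul]
    exact le_mul_of_one_le_left (abs_nonneg _) (one_le_abs_cast hg')
  have hone := one_le_abs_cast hpr
  have e : ((p 0 * r ^ 2 + p 1 * (r * s) + p 2 * s ^ 2 : ℤ) : ℝ) = r ^ 2 * ev3 ζ (castVec p)
      - (p 1 * (ζ * r ^ 2 - r * s) + p 2 * (ζ * (ζ * r ^ 2 - r * s) + (ζ * (r * s) - s ^ 2))) := by
    simp only [ev3, castVec]; push_cast; ring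
  rw [e] at hone
  have b1 : |(r : ℝ) ^ 2 * ev3 ζ (castVec p)| ≤ H ^ 2 * |ev3 ζ (castVec p)| := by
    rw [abs_mul, abs_pow]; gcongr
  have b2 : |p 1 * (ζ * r ^ 2 - r * s)| ≤ H * L := by
    rw [abs_mul]; exact mul_le_mul (hp 1) hd0 (abs_nonneg _) hH
  have b3 : |ζ * (ζ * r ^ 2 - r * s) + (ζ * (r * s) - s ^ 2)| ≤ |ζ| * L + L := by
    refine (abs_add_le _ _).trans (add_le_add ?_ hd1)
    rw [abs_mul]; gcongr
  have b4 : |p 2 * (ζ * (ζ * r ^ 2 - r * s) + (ζ * (r * s) - s ^ 2))| ≤ H * (|ζ| * L + L) := by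
    rw [abs_mul]; exact mul_le_mul (hp 2) b3 (abs_nonneg _) hH
  have b5 := abs_sub ((r : ℝ) ^ 2 * ev3 ζ (castVec p))
    (p 1 * (ζ * r ^ 2 - r * s) + p 2 * (ζ * (ζ * r ^ 2 - r * s) + (ζ * (r * s) - s ^ 2)))
  have b6 := abs_add_le (p 1 * (ζ * r ^ 2 - r * s) : ℝ)
    (p 2 * (ζ * (ζ * r ^ 2 - r * s) + (ζ * (r * s) - s ^ 2)))
  have : 0 ≤ H * L := mul_nonneg hH ((abs_nonneg _).trans h0)
  have : 0 ≤ |ζ| * (H * L) := by positivity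
  linarith

/-- A pair of indices `l < m` such that `P l`, `P (l + 1) = ± P m`, `P (m + 1)` are consecutive
distinct minimal polynomials, and are linearly independent. -/
structure IsTurn (ζ : ℝ) (P : ℕ → Fin 3 → ℤ) (l m : ℕ) : Prop where
  lt : l < m
  drop_left : absEv ζ (P (l + 1)) < absEv ζ (P l)
  drop_right : absEv ζ (P (m + 1)) < absEv ζ (P m)
  eq : absEv ζ (P (l + 1)) = absEv ζ (P m)
  det_ne_zero : det3 (P l) (P (l + 1)) (P (m + 1)) ≠ 0

lemma conic_ne_zero_of_parallel {a b : Fin 3 → ℤ} (ha : a ≠ 0) (hb : b ≠ 0)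
    (h : ∀ i j, a i * b j = a j * b i) (hn : a 1 ^ 2 - a 0 * a 2 ≠ 0) :
    b 1 ^ 2 - b 0 * b 2 ≠ 0 := by
  obtain ⟨z, k, l, hk, hl, h1, h2⟩ := exists_common_divisor ha hb h
  rw [h1, h1, h1] at hn
  rw [h2, h2, h2]
  have hz : z 1 ^ 2 - z 0 * z 2 ≠ 0 := fun h => hn (by linear_combination k ^ 2 * h)
  have : (l * z 1) ^ 2 - l * z 0 * (l * z 2) = l ^ 2 * (z 1 ^ 2 - z 0 * z 2) := by ring
  rw [this]
  exact mul_ne_zero (pow_ne_zero 2 hl) hz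

lemma mul_ne_of_transcendental {ζ : ℝ} (hζ : Transcendental ℚ ζ) {q p : ℤ}
    (h : ζ * q = p) : q = 0 ∧ p = 0 := by
  by_contra hne
  refine ev3_ne_zero hζ (v := ![-p, q, 0]) (fun h0 => hne ?_) ?_
  · exact ⟨by simpa using congrFun h0 1, by simpa using congrFun h0 0⟩
  · simp [ev3, castVec]; linarith

namespace IsMinimalSeq

variable {ζ : ℝ} {P : ℕ → Fin 3 → ℤ}

lemma coeff_le_add_two (hP : IsMinimalSeq ζ P) (n : ℕ) (i : Fin 3) :
    |castVec (P n) i| ≤ (n : ℝ) + 2 := (hP.coeff_le n i).trans (by linarith)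

lemma coeff_succ_le (hP : IsMinimalSeq ζ P) (n : ℕ) (i : Fin 3) :
    |castVec (P (n + 1)) i| ≤ (n : ℝ) + 2 :=
  (hP.coeff_le (n + 1) i).trans (by push_cast; linarith)

lemma abs_mul_cross_sub_le (hP : IsMinimalSeq ζ P) (l : ℕ) :
    |ζ * castVec (cross (P l) (P (l + 1))) 0 - castVec (cross (P l) (P (l + 1))) 1|
        ≤ 4 * (1 + |ζ|) * ((l + 2) * absEv ζ (P l)) ∧
    |ζ * castVec (cross (P l) (P (l + 1))) 1 - castVec (cross (P l) (P (l + 1))) 2|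
        ≤ 4 * (1 + |ζ|) * ((l + 2) * absEv ζ (P l)) := by
  have h := ExtremalCubic.abs_mul_cross_sub_le (ζ := ζ) (hP.coeff_le_add_two l) (hP.coeff_succ_le l)
  have hanti : absEv ζ (P (l + 1)) ≤ absEv ζ (P l) := hP.antitone (Nat.le_succ l)
  have hle : 2 * (1 + |ζ|) * (absEv ζ (P l) * (l + 2) + absEv ζ (P (l + 1)) * (l + 2))
      ≤ 4 * (1 + |ζ|) * ((l + 2) * absEv ζ (P l)) := by
    have : absEv ζ (P (l + 1)) * ((l : ℝ) + 2) ≤ absEv ζ (P l) * (l + 2) := by gcongr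
    have h1 : 0 ≤ 1 + |ζ| := by positivity
    nlinarith
  rw [castVec_cross]
  exact ⟨h.1.trans hle, h.2.trans hle⟩

lemma exists_drop (hP : IsMinimalSeq ζ P) (hζ : Transcendental ℚ ζ)
    (hlim : Filter.Tendsto (fun n : ℕ => ((n : ℝ) + 2) * absEv ζ (P n)) Filter.atTop (nhds 0))
    (N : ℕ) : ∃ n, N ≤ n ∧ absEv ζ (P (n + 1)) < absEv ζ (P n) := by
  by_contra! h
  have hconst : ∀ n, absEv ζ (P N) ≤ absEv ζ (P (N + n)) := by
    intro n
    induction n with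
    | zero => exact le_rfl
    | succ n ih => exact ih.trans (h (N + n) (by omega))
  have hpos : 0 < absEv ζ (P N) := abs_pos.mpr (ev3_ne_zero hζ (hP.ne_zero N))
  obtain ⟨M, hM⟩ := Filter.eventually_atTop.mp (hlim.eventually (gt_mem_nhds hpos))
  have h1 := hM (N + M) (by omega)
  have h2 := hconst M
  have h3 : absEv ζ (P (N + M)) ≤ (((N + M : ℕ) : ℝ) + 2) * absEv ζ (P (N + M)) :=
    le_mul_of_one_le_left (abs_nonneg _) (by have : (0 : ℝ) ≤ (N + M : ℕ) := by positivity
                                             linarith)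
  linarith

lemma exists_det3_ne_zero (hP : IsMinimalSeq ζ P) (hζ : Transcendental ℚ ζ)
    (hlim : Filter.Tendsto (fun n : ℕ => ((n : ℝ) + 2) * absEv ζ (P n)) Filter.atTop (nhds 0))
    {m : ℕ} (hm : absEv ζ (P (m + 1)) < absEv ζ (P m)) :
    ∃ j, m ≤ j ∧ det3 (P m) (P (m + 1)) (P (j + 1)) ≠ 0 := by
  by_contra! h
  have hV : ∀ i, m ≤ i → det3 (P m) (P (m + 1)) (P i) = 0 := by
    intro i hi
    rcases hi.lt_or_eq with h' | h'
    · obtain ⟨i, rfl⟩ : ∃ i', i = i' + 1 := ⟨i - 1, by omega⟩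
      exact h i (by omega)
    · rw [← h']; simp [det3]; ring
  have ha : cross (P m) (P (m + 1)) ≠ 0 := hP.cross_ne_zero hm
  set a := cross (P m) (P (m + 1)) with ha'
  have hS : ∀ l, m ≤ l → absEv ζ (P (l + 1)) < absEv ζ (P l) →
      |ζ * castVec a 0 - castVec a 1| ≤ (∑ i, |(a i : ℝ)|) *
        (4 * (1 + |ζ|) * ((l + 2) * absEv ζ (P l))) ∧
      |ζ * castVec a 1 - castVec a 2| ≤ (∑ i, |(a i : ℝ)|) *
        (4 * (1 + |ζ|) * ((l + 2) * absEv ζ (P l))) := by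
    intro l hl hd
    obtain ⟨z, k, n, hk, hn, h1, h2⟩ := exists_common_divisor ha (hP.cross_ne_zero hd)
      (cross_parallel (hV l hl) (hV (l + 1) (by omega)))
    obtain ⟨i, hi⟩ := Function.ne_iff.mp ha
    have hkS : |(k : ℝ)| ≤ ∑ i, |(a i : ℝ)| := by
      refine le_trans ?_ (Finset.single_le_sum (f := fun i => |(a i : ℝ)|)
        (fun _ _ => abs_nonneg _) (Finset.mem_univ i))
      have hzi : z i ≠ 0 := fun h => hi (by rw [h1, h, mul_zero]; rfl)
      exact abs_le_of_mul_eq hzi (by rw [h1]; ring)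
    have hb := hP.abs_mul_cross_sub_le l
    have key : ∀ i j, |ζ * castVec a i - castVec a j| = |(k : ℝ)| * |ζ * z i - z j| := by
      intro i j
      rw [← abs_mul]
      congr 1
      change ζ * (a i : ℝ) - a j = _
      rw [h1, h1]; push_cast; ring
    rw [key, key]
    exact ⟨mul_le_mul hkS ((abs_mul_sub_le_of_eq_mul hn h2 0 1).trans hb.1) (abs_nonneg _)
        (by positivity),
      mul_le_mul hkS ((abs_mul_sub_le_of_eq_mul hn h2 1 2).trans hb.2) (abs_nonneg _)
        (by positivity)⟩
  have hlim' : Filter.Tendsto (fun l : ℕ => (∑ i, |(a i : ℝ)|) *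
      (4 * (1 + |ζ|) * (((l : ℝ) + 2) * absEv ζ (P l)))) Filter.atTop (nhds 0) := by
    simpa using (hlim.const_mul (4 * (1 + |ζ|))).const_mul (∑ i, |(a i : ℝ)|)
  have hzero : ∀ x : ℝ, (∀ l, m ≤ l → absEv ζ (P (l + 1)) < absEv ζ (P l) →
      |x| ≤ (∑ i, |(a i : ℝ)|) * (4 * (1 + |ζ|) * ((l + 2) * absEv ζ (P l)))) → x = 0 := by
    intro x hx
    by_contra hne
    obtain ⟨M, hM⟩ := Filter.eventually_atTop.mp
      (hlim'.eventually (gt_mem_nhds (abs_pos.mpr hne)))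
    obtain ⟨n, hn, hd⟩ := hP.exists_drop hζ hlim (max M m)
    have h1 := hM n (le_trans (le_max_left _ _) hn)
    have h2 := hx n (le_trans (le_max_right _ _) hn) hd
    linarith
  have e0 := mul_ne_of_transcendental hζ
    (sub_eq_zero.mp (hzero _ fun l hl hd => (hS l hl hd).1))
  have e1 := mul_ne_of_transcendental hζ
    (sub_eq_zero.mp (hzero _ fun l hl hd => (hS l hl hd).2))
  apply ha
  funext i
  fin_cases i
  · exact e0.1
  · exact e0.2
  · exact e1.2

lemma exists_isTurn (hP : IsMinimalSeq ζ P) (hζ : Transcendental ℚ ζ)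
    (hlim : Filter.Tendsto (fun n : ℕ => ((n : ℝ) + 2) * absEv ζ (P n)) Filter.atTop (nhds 0))
    {m : ℕ} (hm : absEv ζ (P (m + 1)) < absEv ζ (P m)) :
    ∃ l j, m ≤ l ∧ IsTurn ζ P l j ∧
      det3 (P m) (P (m + 1)) (P l) = 0 ∧ det3 (P m) (P (m + 1)) (P (l + 1)) = 0 := by
  obtain ⟨l, j, h1, h2, h3, h4, h5, h6, h7, h8⟩ :=
    hP.exists_next hζ hm (hP.exists_det3_ne_zero hζ hlim hm)
  exact ⟨l, j, h1, ⟨h2, h3, h4, h5, h8⟩, h6, h7⟩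

lemma one_le_of_isTurn (hP : IsMinimalSeq ζ P) {l m : ℕ} (h : IsTurn ζ P l m) :
    1 ≤ 6 * (((l : ℝ) + 2) * (m + 2) * absEv ζ (P l)) := by
  have h1 := one_le_abs_cast h.det_ne_zero
  rw [det3_cast] at h1
  have h2 := abs_det3_le ζ (hP.coeff_le_add_two l) (hP.coeff_succ_le l) (hP.coeff_succ_le m)
  have hlm : (l : ℝ) ≤ m := by exact_mod_cast h.lt.le
  have e1 : absEv ζ (P (l + 1)) ≤ absEv ζ (P l) := h.drop_left.le
  have e2 : absEv ζ (P (m + 1)) ≤ absEv ζ (P l) := hP.antitone (by have := h.lt; omega)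
  have b1 : absEv ζ (P (l + 1)) * (((l : ℝ) + 2) * (m + 2)) ≤
      absEv ζ (P l) * ((l + 2) * (m + 2)) := by gcongr
  have b2 : absEv ζ (P (m + 1)) * (((l : ℝ) + 2) * (l + 2)) ≤
      absEv ζ (P l) * ((l + 2) * (m + 2)) := by gcongr
  linarith

lemma isTurn_succ (hP : IsMinimalSeq ζ P) (hζ : Transcendental ℚ ζ) {l₀ m l j : ℕ}
    (h : IsTurn ζ P l₀ m) (h' : IsTurn ζ P l j) (hml : m ≤ l)
    (hl : det3 (P m) (P (m + 1)) (P l) = 0) (hl' : det3 (P m) (P (m + 1)) (P (l + 1)) = 0)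
    (hres : res (P (l₀ + 1)) (P (m + 1)) ≠ 0) :
    res (P (l₀ + 1)) (P (l + 1)) ≠ 0 ∧
      1 ≤ 16 * (1 + |ζ|) * (((l₀ : ℝ) + 2) * (m + 2) * ((l + 2) * absEv ζ (P l))) := by
  have hV0 : det3 (P m) (P (m + 1)) (P (l₀ + 1)) = 0 :=
    det3_eq_zero_of_absEv_eq hζ h.eq (by simp [det3]; ring)
  have hV1 : det3 (P m) (P (m + 1)) (P (m + 1)) = 0 := by simp [det3]; ring
  have ha : cross (P (l₀ + 1)) (P (m + 1)) ≠ 0 := hP.cross_ne_zero (by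
    rw [h.eq]; exact h.drop_right)
  have hm0 : cross (P m) (P (m + 1)) ≠ 0 := hP.cross_ne_zero h.drop_right
  have hpar : ∀ {a b c d : Fin 3 → ℤ}, det3 (P m) (P (m + 1)) a = 0 →
      det3 (P m) (P (m + 1)) b = 0 → det3 (P m) (P (m + 1)) c = 0 →
      det3 (P m) (P (m + 1)) d = 0 → ∀ i j, cross a b i * cross c d j
        = cross a b j * cross c d i := by
    intro a b c d h1 h2 h3 h4 i j
    obtain ⟨i₀, hi₀⟩ := Function.ne_iff.mp hm0
    apply mul_left_cancel₀ (mul_ne_zero hi₀ hi₀)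
    have a1 := cross_parallel h1 h2 i i₀
    have a2 := cross_parallel h1 h2 j i₀
    have a3 := cross_parallel h3 h4 i i₀
    have a4 := cross_parallel h3 h4 j i₀
    calc _ = (cross (P m) (P (m + 1)) i₀ * cross a b i)
          * (cross (P m) (P (m + 1)) i₀ * cross c d j) := by ring
      _ = (cross (P m) (P (m + 1)) i₀ * cross a b j)
          * (cross (P m) (P (m + 1)) i₀ * cross c d i) := by
          rw [← a1, ← a2, ← a3, ← a4]; ring
      _ = _ := by ring
  rw [res_eq_cross] at hres
  constructor
  · rw [res_eq_cross]
    refine conic_ne_zero_of_parallel ha (hP.cross_ne_zero ?_) (hpar hV0 hV1 hV0 hl') hres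
    rw [h.eq]
    exact lt_of_le_of_lt (hP.antitone (Nat.succ_le_succ hml)) h.drop_right
  · obtain ⟨z, k, n, hk, hn, h1, h2⟩ := exists_common_divisor ha (hP.cross_ne_zero h'.drop_left)
      (hpar hV0 hV1 hl hl')
    have hz : z 1 ^ 2 - z 0 * z 2 ≠ 0 := by
      rw [h1, h1, h1] at hres
      exact fun h => hres (by linear_combination k ^ 2 * h)
    have hone := one_le_abs_cast hz
    have hb := hP.abs_mul_cross_sub_le l
    have hzb : ∀ i, |castVec z i| ≤ 2 * (((l₀ : ℝ) + 2) * (m + 2)) := by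
      intro i
      refine (abs_le_of_mul_eq hk (h1 i)).trans ?_
      have := abs_cross_le (hP.coeff_succ_le l₀) (hP.coeff_succ_le m) i
      rwa [← castVec_cross] at this
    have := abs_sq_sub_mul_le hzb ((abs_mul_sub_le_of_eq_mul hn h2 0 1).trans hb.1)
      ((abs_mul_sub_le_of_eq_mul hn h2 1 2).trans hb.2)
    push_cast at hone
    linarith

lemma res_ne_zero_of_isTurn (hP : IsMinimalSeq ζ P) {l m : ℕ} (h : IsTurn ζ P l m)
    (hsmall : 4 * (1 + |ζ|) * (((m : ℝ) + 2) * absEv ζ (P m)) < 1)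
    (hsmall' : ((l : ℝ) + 2) ^ 2 * absEv ζ (P l)
      + (2 + 2 * |ζ|) * ((l + 2) * (4 * (1 + |ζ|) * ((m + 2) * absEv ζ (P m)))) < 1) :
    res (P (l + 1)) (P (m + 1)) ≠ 0 := by
  intro hres
  rw [res_eq_cross] at hres
  have h1 : |ζ * castVec (cross (P (l + 1)) (P (m + 1))) 0
        - castVec (cross (P (l + 1)) (P (m + 1))) 1|
        ≤ 4 * (1 + |ζ|) * ((m + 2) * absEv ζ (P m)) ∧
      |ζ * castVec (cross (P (l + 1)) (P (m + 1))) 1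
        - castVec (cross (P (l + 1)) (P (m + 1))) 2|
        ≤ 4 * (1 + |ζ|) * ((m + 2) * absEv ζ (P m)) := by
    have hlm : (l : ℝ) ≤ m := by exact_mod_cast h.lt.le
    have hb := ExtremalCubic.abs_mul_cross_sub_le (ζ := ζ)
      (fun i => (hP.coeff_succ_le l i).trans (by linarith : (l : ℝ) + 2 ≤ m + 2))
      (hP.coeff_succ_le m)
    have hle : 2 * (1 + |ζ|) * (absEv ζ (P (l + 1)) * (m + 2) + absEv ζ (P (m + 1)) * (m + 2))
        ≤ 4 * (1 + |ζ|) * ((m + 2) * absEv ζ (P m)) := by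
      rw [h.eq]
      have : absEv ζ (P (m + 1)) * ((m : ℝ) + 2) ≤ absEv ζ (P m) * (m + 2) := by
        have := h.drop_right.le
        gcongr
      have h1 : 0 ≤ 1 + |ζ| := by positivity
      nlinarith
    rw [castVec_cross]
    exact ⟨hb.1.trans hle, hb.2.trans hle⟩
  have := one_le_of_conic (hP.coeff_le_add_two l) (hP.coeff_succ_le l) (hP.ne_zero _)
    (sub_eq_zero.mp hres) (hP.cross_ne_zero (by rw [h.eq]; exact h.drop_right))
    (by simp [cross]; ring) (by
      have hd := h.det_ne_zero
      intro h0
      apply hd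
      rw [← h0]
      simp [det3, cross]; ring) h1.1 h1.2 hsmall
  linarith

end IsMinimalSeq

lemma abs_coeff_le_polyH (P : ℤ[X]) (i : ℕ) : |(P.coeff i : ℝ)| ≤ polyH P := by
  unfold polyH
  by_cases h : i ∈ P.support
  · have := Finset.le_sup (f := fun i => (P.coeff i).natAbs) h
    rw [← Int.cast_abs, Int.abs_eq_natAbs, Int.cast_natCast]
    exact_mod_cast this
  · rw [notMem_support_iff.mp h]
    simp

lemma pev_eq_ev3 (ζ : ℝ) {P : ℤ[X]} (hP : P.natDegree ≤ 2) :
    pev ζ P = ev3 ζ (castVec ![P.coeff 0, P.coeff 1, P.coeff 2]) := by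
  unfold pev
  rw [aeval_eq_sum_range' (Nat.lt_succ_of_le hP)]
  simp [Finset.sum_range_succ, ev3, castVec]

lemma pev_eq_ev4 (ζ : ℝ) {P : ℤ[X]} (hP : P.natDegree ≤ 3) :
    pev ζ P = ev4 ζ (castVec ![P.coeff 0, P.coeff 1, P.coeff 2, P.coeff 3]) := by
  unfold pev
  rw [aeval_eq_sum_range' (Nat.lt_succ_of_le hP)]
  simp [Finset.sum_range_succ, ev4, castVec]

open Real Filter in
lemma IsMinimalSeq.exists_log_le {ζ w : ℝ} {P : ℕ → Fin 3 → ℤ} (hP : IsMinimalSeq ζ P)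
    (hζ : IsExtremal ζ) (hw0 : 0 < w) (hw : w < goldenRatio + 1) :
    ∃ N : ℕ, ∀ n, N ≤ n →
      log (absEv ζ (P n)) ≤ w * log 2 - w * log ((n : ℝ) + 2) := by
  have hsup : w < sSup (whSet 2 ζ) := by
    have : whExp 2 ζ = goldenRatio + 1 := by rw [hζ.2, goldenRatio]; ring
    rwa [← whExp, this]
  have hne : (whSet 2 ζ).Nonempty := by
    by_contra h
    rw [Set.not_nonempty_iff_eq_empty.mp h, Real.sSup_empty] at hsup
    linarith
  obtain ⟨η, ⟨X₀, hX⟩, hη⟩ := exists_lt_of_lt_csSup hne hsup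
  refine ⟨⌈X₀⌉₊, fun n hn => ?_⟩
  have hn' : X₀ ≤ n := (Nat.le_ceil _).trans (by exact_mod_cast hn)
  have hn0 : (0 : ℝ) ≤ n := Nat.cast_nonneg n
  obtain ⟨p, hdeg, hH, hpos, hle⟩ := hX (n + 1) (by linarith)
  rw [pev_eq_ev3 ζ hdeg] at hpos hle
  have hmin := hP.le_of_coeff_le n ![p.coeff 0, p.coeff 1, p.coeff 2]
    (fun h => by rw [h] at hpos; simp [ev3, castVec] at hpos)
    (fun i => by
      refine le_trans ?_ hH
      fin_cases i
      · exact abs_coeff_le_polyH p 0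
      · exact abs_coeff_le_polyH p 1
      · exact abs_coeff_le_polyH p 2)
  have h1 := log_le_log (abs_pos.mpr (ev3_ne_zero hζ.1 (hP.ne_zero n))) (hmin.trans hle)
  rw [log_rpow (by positivity)] at h1
  have h2 : 0 ≤ log ((n : ℝ) + 1) := log_nonneg (by linarith)
  have h3 : log ((n : ℝ) + 2) ≤ log 2 + log ((n : ℝ) + 1) := by
    rw [← log_mul (by norm_num) (by positivity)]
    exact log_le_log (by positivity) (by linarith)
  nlinarith

/-- A sequence of quadratic integer polynomials with heights bounded by `exp (t k)`, growing
geometrically in logarithmic scale with ratio close to the golden ratio, which take small values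
at `ζ` and are such that consecutive ones are coprime. -/
structure IsGoodSeq (ζ ε K : ℝ) (Q : ℕ → Fin 3 → ℤ) (t : ℕ → ℝ) : Prop where
  le_t : ∀ k, K ≤ t k
  lower : ∀ k, (Real.goldenRatio - ε) * t k ≤ t (k + 1)
  upper : ∀ k, t (k + 1) ≤ (Real.goldenRatio + ε) * t k
  coeff_le : ∀ k i, |castVec (Q k) i| ≤ Real.exp (t k)
  small : ∀ k, absEv ζ (Q k) ≤ Real.exp (-((2 * Real.goldenRatio + 1 - ε) * t k))
  res_ne_zero : ∀ k, res (Q k) (Q (k + 1)) ≠ 0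

lemma log_growth_bounds {ε κ θ w τ η τ' : ℝ} (hε : 0 < ε) (hε1 : ε ≤ 1) (hκ : 0 ≤ κ)
    (hθ : θ = ε / 10) (hw : w = Real.goldenRatio + 1 - θ) (hτ : 20 * κ ≤ ε * τ) (hτ0 : 0 ≤ τ)
    (h1 : 0 ≤ κ + τ + η + (κ - w * τ)) (h2 : 0 ≤ κ + τ + η + τ' + (κ - w * τ')) (h3 : η ≤ τ') :
    (Real.goldenRatio - ε) * τ ≤ τ' ∧ τ' ≤ (Real.goldenRatio + ε) * τ ∧
      κ - w * η ≤ -((2 * Real.goldenRatio + 1 - ε) * τ) := by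
  have g1 : 1.618 < Real.goldenRatio := by
    have : (2.236 : ℝ) < Real.sqrt 5 := Real.lt_sqrt_of_sq_lt (by norm_num)
    rw [Real.goldenRatio]; linarith
  have g2 : Real.goldenRatio < 1.6181 := by
    have : Real.sqrt 5 < 2.2362 := (Real.sqrt_lt' (by norm_num)).mpr (by norm_num)
    rw [Real.goldenRatio]; linarith
  have g3 := Real.goldenRatio_sq
  set φ := Real.goldenRatio
  subst hθ hw
  have hετ : 0 ≤ ε * τ := by positivity
  have hη : (φ - ε / 10) * τ - 2 * κ ≤ η := by linarith
  refine ⟨by linarith, ?_, ?_⟩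
  · have h4 : (φ - 1 - ε / 10) * τ' ≤ τ + 2 * κ := by linarith
    have h5 : τ + 2 * κ ≤ (φ - 1 - ε / 10) * ((φ + ε) * τ) := by
      have : (φ - 1 - ε / 10) * ((φ + ε) * τ)
        = τ + (φ - 1 - φ / 10 - ε / 10) * (ε * τ) := by linear_combination τ * g3
      rw [this]
      have : (0.3 : ℝ) * (ε * τ) ≤ (φ - 1 - φ / 10 - ε / 10) * (ε * τ) := by
        gcongr; linarith
      linarith
    exact le_of_mul_le_mul_left (h4.trans h5) (by linarith)
  · have h4 : (φ + 1 - ε / 10) * ((φ - ε / 10) * τ - 2 * κ) ≤ (φ + 1 - ε / 10) * η := by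
      gcongr; linarith
    have h5 : (φ + 1 - ε / 10) * ((φ - ε / 10) * τ - 2 * κ)
        = (2 * φ + 1) * τ - (2 * φ + 1) / 10 * (ε * τ) + ε / 100 * (ε * τ)
          - 2 * (φ + 1 - ε / 10) * κ := by linear_combination τ * g3
    have h6 : 2 * (φ + 1 - ε / 10) * κ ≤ 6 * κ := by gcongr; linarith
    have h7 : (2 * φ + 1) / 10 * (ε * τ) ≤ 0.43 * (ε * τ) := by gcongr; linarith
    have h8 : 0 ≤ ε / 100 * (ε * τ) := by positivity
    linarith

open Real Filter Topology in
theorem exists_isGoodSeq {ζ : ℝ} (hζ : IsExtremal ζ) {ε : ℝ} (hε : 0 < ε) (hε1 : ε ≤ 1) (K : ℝ) :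
    ∃ Q t, IsGoodSeq ζ ε K Q t := by
  obtain ⟨P, hP⟩ := exists_isMinimalSeq ζ
  have g1 : 1.618 < goldenRatio := by
    have : (2.236 : ℝ) < √5 := Real.lt_sqrt_of_sq_lt (by norm_num)
    rw [Real.goldenRatio]; linarith
  set w := goldenRatio + 1 - ε / 10 with hw
  obtain ⟨N₀, hN₀⟩ := hP.exists_log_le (w := w) hζ (by linarith) (by linarith)
  have hpos : ∀ n, 0 < absEv ζ (P n) := fun n => abs_pos.mpr (ev3_ne_zero hζ.1 (hP.ne_zero n))
  have hL : Tendsto (fun n : ℕ => log ((n : ℝ) + 2)) atTop atTop :=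
    tendsto_log_atTop.comp (tendsto_atTop_add_const_right _ _ tendsto_natCast_atTop_atTop)
  have hlim2 : Tendsto (fun n : ℕ => ((n : ℝ) + 2) ^ 2 * absEv ζ (P n)) atTop (𝓝 0) := by
    have h0 : Tendsto (fun n : ℕ => exp (-((w - 2) * log ((n : ℝ) + 2) - w * log 2))) atTop
        (𝓝 0) := by
      refine tendsto_exp_neg_atTop_nhds_zero.comp ?_
      exact tendsto_atTop_add_const_right _ _ (hL.const_mul_atTop (by linarith))
    refine squeeze_zero' (Eventually.of_forall fun n => by positivity) ?_ h0
    filter_upwards [eventually_ge_atTop N₀] with n hn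
    have hn2 : (0 : ℝ) < (n : ℝ) + 2 := by positivity
    rw [← log_le_iff_le_exp (by have := hpos n; positivity),
      log_mul (by positivity) (hpos n).ne', log_pow]
    have := hN₀ n hn
    push_cast
    linarith
  have hlim : Tendsto (fun n : ℕ => ((n : ℝ) + 2) * absEv ζ (P n)) atTop (𝓝 0) := by
    refine squeeze_zero (fun n => by positivity) (fun n => ?_) hlim2
    have : (0 : ℝ) ≤ n := Nat.cast_nonneg n
    gcongr
    nlinarith
  set κ := max (w * log 2) (max (log 6) (log (16 * (1 + |ζ|)))) with hκ
  have hκ1 : w * log 2 ≤ κ := le_max_left _ _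
  have hκ2 : log 6 ≤ κ := (le_max_left _ _).trans (le_max_right _ _)
  have hκ3 : log (16 * (1 + |ζ|)) ≤ κ := (le_max_right _ _).trans (le_max_right _ _)
  have hκ0 : 0 ≤ κ := (log_nonneg (by norm_num)).trans hκ2
  have hσ : 0 < 1 / (10 * (1 + |ζ|) ^ 2) := by positivity
  obtain ⟨N₁, hN₁⟩ := eventually_atTop.mp (hlim2.eventually (gt_mem_nhds hσ))
  obtain ⟨N₂, hN₂⟩ := eventually_atTop.mp
    (hL.eventually (eventually_ge_atTop (max K (max 0 (20 * κ / ε)))))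
  set N := max N₀ (max N₁ N₂) with hN
  have hN0 : N₀ ≤ N := le_max_left _ _
  have hN1 : N₁ ≤ N := (le_max_left _ _).trans (le_max_right _ _)
  have hN2 : N₂ ≤ N := (le_max_right _ _).trans (le_max_right _ _)
  have hcop : ∀ l m, N ≤ l → IsTurn ζ P l m → res (P (l + 1)) (P (m + 1)) ≠ 0 := by
    intro l m hl h
    have hlm := h.lt
    have hlm' : (l : ℝ) ≤ m := by exact_mod_cast hlm.le
    have hl' := hN₁ l (by omega)
    have hm' := hN₁ m (by omega)
    have hz := abs_nonneg ζ
    rw [lt_div_iff₀ (by positivity)] at hl' hm'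
    have e1 : ((m : ℝ) + 2) * absEv ζ (P m) ≤ ((m : ℝ) + 2) ^ 2 * absEv ζ (P m) := by
      gcongr
      nlinarith [Nat.cast_nonneg (α := ℝ) m]
    have e2 : ((l : ℝ) + 2) * (((m : ℝ) + 2) * absEv ζ (P m))
        ≤ ((m : ℝ) + 2) ^ 2 * absEv ζ (P m) := by
      rw [sq, mul_assoc]; gcongr
    set x := ((m : ℝ) + 2) ^ 2 * absEv ζ (P m)
    set y := ((l : ℝ) + 2) ^ 2 * absEv ζ (P l)
    have hx0 : 0 ≤ x := by positivity
    have hy0 : 0 ≤ y := by positivity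
    refine hP.res_ne_zero_of_isTurn h ?_ ?_
    · have : 4 * (1 + |ζ|) * (((m : ℝ) + 2) * absEv ζ (P m)) ≤ 4 * (1 + |ζ|) * x := by gcongr
      nlinarith [mul_nonneg hx0 hz, mul_nonneg hx0 (mul_nonneg hz hz)]
    · have : (2 + 2 * |ζ|) * ((l + 2) * (4 * (1 + |ζ|) * ((m + 2) * absEv ζ (P m))))
          ≤ (8 * (1 + |ζ|) ^ 2) * x := by
        calc _ = (8 * (1 + |ζ|) ^ 2) * (((l : ℝ) + 2) * (((m : ℝ) + 2) * absEv ζ (P m))) := by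
              ring
          _ ≤ _ := by gcongr
      nlinarith [mul_nonneg hy0 hz, mul_nonneg hy0 (mul_nonneg hz hz)]
  have hnext : ∀ s : {s : ℕ × ℕ // IsTurn ζ P s.1 s.2 ∧ N ≤ s.1},
      ∃ s' : {s : ℕ × ℕ // IsTurn ζ P s.1 s.2 ∧ N ≤ s.1}, s.1.2 ≤ s'.1.1 ∧
        det3 (P s.1.2) (P (s.1.2 + 1)) (P s'.1.1) = 0 ∧
        det3 (P s.1.2) (P (s.1.2 + 1)) (P (s'.1.1 + 1)) = 0 := by
    rintro ⟨⟨l₀, m⟩, hs, hNl⟩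
    obtain ⟨l, j, hml, ht, h1, h2⟩ := hP.exists_isTurn hζ.1 hlim hs.drop_right
    have := hs.lt
    exact ⟨⟨(l, j), ht, by simp at *; omega⟩, hml, h1, h2⟩
  choose next hle hd1 hd2 using hnext
  obtain ⟨m, hm, hdrop⟩ := hP.exists_drop hζ.1 hlim N
  obtain ⟨l, j, hml, ht, -, -⟩ := hP.exists_isTurn hζ.1 hlim hdrop
  let S : ℕ → {s : ℕ × ℕ // IsTurn ζ P s.1 s.2 ∧ N ≤ s.1} :=
    fun k => next^[k] ⟨(l, j), ht, hm.trans hml⟩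
  have hS : ∀ k, S (k + 1) = next (S k) := fun k => Function.iterate_succ_apply' _ _ _
  have hbig : ∀ k, max K (max 0 (20 * κ / ε)) ≤ log (((S k).1.1 : ℝ) + 2) :=
    fun k => hN₂ _ (hN2.trans (S k).2.2)
  have hstep : ∀ k, res (P ((S k).1.1 + 1)) (P ((S (k + 1)).1.1 + 1)) ≠ 0 ∧
      (goldenRatio - ε) * log (((S k).1.1 : ℝ) + 2) ≤ log (((S (k + 1)).1.1 : ℝ) + 2) ∧
      log (((S (k + 1)).1.1 : ℝ) + 2) ≤ (goldenRatio + ε) * log (((S k).1.1 : ℝ) + 2) ∧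
      log (absEv ζ (P ((S k).1.1 + 1)))
        ≤ -((2 * goldenRatio + 1 - ε) * log (((S k).1.1 : ℝ) + 2)) := by
    intro k
    rw [hS]
    have hk := hbig k
    obtain ⟨h1, h2⟩ := hP.isTurn_succ hζ.1 (S k).2.1 (next (S k)).2.1 (hle _) (hd1 _) (hd2 _)
      (hcop _ _ (S k).2.2 (S k).2.1)
    have h3 := hP.one_le_of_isTurn (S k).2.1
    have h4 := hN₀ (S k).1.1 (hN0.trans (S k).2.2)
    have h5 := hN₀ (next (S k)).1.1 (hN0.trans (next (S k)).2.2)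
    have h6 := hN₀ (S k).1.2 (hN0.trans ((S k).2.2.trans (S k).2.1.lt.le))
    have h7 : log (((S k).1.2 : ℝ) + 2) ≤ log (((next (S k)).1.1 : ℝ) + 2) := by
      have : ((S k).1.2 : ℝ) ≤ (next (S k)).1.1 := by exact_mod_cast hle (S k)
      exact log_le_log (by positivity) (by linarith)
    have q1 : (0 : ℝ) < ((S k).1.1 : ℝ) + 2 := by positivity
    have q2 : (0 : ℝ) < ((S k).1.2 : ℝ) + 2 := by positivity
    have q3 : (0 : ℝ) < ((next (S k)).1.1 : ℝ) + 2 := by positivity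
    have q4 := hpos (S k).1.1
    have q5 := hpos (next (S k)).1.1
    have h2' := log_nonneg h2
    have h3' := log_nonneg h3
    rw [log_mul (by positivity : 16 * (1 + |ζ|) ≠ 0) (by positivity),
      log_mul (mul_pos q1 q2).ne' (mul_pos q3 q5).ne', log_mul q1.ne' q2.ne',
      log_mul q3.ne' q5.ne'] at h2'
    rw [log_mul (by positivity) (by positivity), log_mul (by positivity) (by positivity),
      log_mul (by positivity) (by positivity)] at h3'
    have hmax : 20 * κ ≤ ε * log (((S k).1.1 : ℝ) + 2) := by
      have := (le_max_right _ _).trans ((le_max_right _ _).trans hk)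
      rw [div_le_iff₀ hε] at this
      linarith
    obtain ⟨r1, r2, r3⟩ := log_growth_bounds hε hε1 hκ0 rfl hw hmax
      ((le_max_left _ _).trans ((le_max_right _ _).trans hk))
      (by linarith : 0 ≤ κ + log (((S k).1.1 : ℝ) + 2) + log (((S k).1.2 : ℝ) + 2)
        + (κ - w * log (((S k).1.1 : ℝ) + 2))) (by linarith) h7
    exact ⟨h1, r1, r2, by rw [(S k).2.1.eq]; linarith⟩
  refine ⟨fun k => P ((S k).1.1 + 1), fun k => log (((S k).1.1 : ℝ) + 2), ?_, fun k => (hstep k).2.1,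
    fun k => (hstep k).2.2.1, fun k i => ?_, fun k => ?_, fun k => (hstep k).1⟩
  · exact fun k => (le_max_left _ _).trans (hbig k)
  · rw [exp_log (by positivity)]
    exact hP.coeff_succ_le _ i
  · rw [← log_le_iff_le_exp (hpos _)]
    exact (hstep k).2.2.2

lemma goldenRatio_bounds : 1.618 < Real.goldenRatio ∧ Real.goldenRatio < 1.6181 := by
  have h1 : (2.236 : ℝ) < Real.sqrt 5 := Real.lt_sqrt_of_sq_lt (by norm_num)
  have h2 : Real.sqrt 5 < 2.2362 := (Real.sqrt_lt' (by norm_num)).mpr (by norm_num)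
  rw [Real.goldenRatio]
  constructor <;> linarith

lemma IsGoodSeq.exists_index {ζ ε K : ℝ} {Q : ℕ → Fin 3 → ℤ} {t : ℕ → ℝ}
    (h : IsGoodSeq ζ ε K Q t) (hε : ε ≤ 1 / 100) (hK : 1 ≤ K) {S : ℝ} {k₀ : ℕ} (hS : t k₀ < S) :
    ∃ k, k₀ ≤ k ∧ t k < S ∧ S ≤ t (k + 1) := by
  have hg := goldenRatio_bounds
  have hgrow : ∀ n : ℕ, 1 + (n : ℝ) / 2 ≤ t n := by
    intro n
    induction n with
    | zero => simpa using hK.trans (h.le_t 0)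
    | succ n ih =>
      have h0 : 1 ≤ t n := hK.trans (h.le_t n)
      have := h.lower n
      push_cast
      nlinarith
  have hex : ∃ n, S ≤ t n := by
    obtain ⟨n, hn⟩ := exists_nat_gt (2 * S)
    exact ⟨n, by have := hgrow n; linarith⟩
  classical
  have hmono : Monotone t := monotone_nat_of_le_succ fun n => by
    have h0 : 1 ≤ t n := hK.trans (h.le_t n)
    have := h.lower n
    nlinarith
  have hn := Nat.find_spec hex
  have hlt : k₀ < Nat.find hex := by
    by_contra! hle
    exact absurd (hn.trans (hmono hle)) (not_le.mpr hS)
  refine ⟨Nat.find hex - 1, by omega, ?_, ?_⟩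
  · exact not_le.mp (Nat.find_min hex (by omega))
  · rwa [Nat.sub_add_cancel (by omega)]

/-- Bounds for three consecutive members of a good sequence, in terms of the logarithmic height
`T` of the middle one and a small quantity `x`. -/
structure IsTriple (ζ T x : ℝ) (A B D : Fin 3 → ℤ) : Prop where
  pos : 1 ≤ x
  const : 1000 * (1 + |ζ|) ^ 3 ≤ Real.exp x
  small : x ≤ T / 100
  coeff_left : ∀ i, |castVec A i| ≤ Real.exp (Real.goldenRatio * T - T + x)
  coeff_mid : ∀ i, |castVec B i| ≤ Real.exp T
  coeff_right : ∀ i, |castVec D i| ≤ Real.exp (Real.goldenRatio * T + x)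
  ev_left : absEv ζ A ≤ Real.exp (-(Real.goldenRatio * T) - T + 5 * x)
  ev_mid : absEv ζ B ≤ Real.exp (-2 * (Real.goldenRatio * T) - T + x)
  ev_right : absEv ζ D ≤ Real.exp (-3 * (Real.goldenRatio * T) - 2 * T + 6 * x)
  res_left : res A B ≠ 0
  res_right : res B D ≠ 0

lemma IsGoodSeq.isTriple {ζ ε K : ℝ} {Q : ℕ → Fin 3 → ℤ} {t : ℕ → ℝ}
    (h : IsGoodSeq ζ ε K Q t) (hε0 : 0 < ε) (hε : ε ≤ 1 / 100) (hK : 1 ≤ ε * K)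
    (hC : 1000 * (1 + |ζ|) ^ 3 ≤ Real.exp (ε * K)) (k : ℕ) :
    IsTriple ζ (t (k + 1)) (ε * t (k + 1)) (Q k) (Q (k + 1)) (Q (k + 2)) := by
  have hg := goldenRatio_bounds
  have hsq := Real.goldenRatio_sq
  have hεK : ε * K ≤ ε * t (k + 1) := by have := h.le_t (k + 1); gcongr
  have ht1 : 0 < t (k + 1) := by
    by_contra! hneg
    nlinarith
  have hl1 := h.lower k
  have hu1 := h.upper k
  have hl2 := h.lower (k + 1)
  have hu2 := h.upper (k + 1)
  have s0 := h.small k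
  have s1 := h.small (k + 1)
  have s2 := h.small (k + 1 + 1)
  set T := t (k + 1)
  set φ := Real.goldenRatio
  have hT0 : 0 ≤ ε * T := by positivity
  have hup : t k ≤ φ * T - T + ε * T := by
    have : (φ - ε) * (φ * T - T + ε * T) = T + (1 - ε) * (ε * T) := by linear_combination T * hsq
    have h2 : 0 ≤ (1 - ε) * (ε * T) := mul_nonneg (by linarith) hT0
    exact le_of_mul_le_mul_left (by linarith : (φ - ε) * t k ≤ (φ - ε) * (φ * T - T + ε * T))
      (by linarith)
  have hlo : φ * T - T - ε * T ≤ t k := by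
    have : (φ + ε) * (φ * T - T - ε * T) = T - (1 + ε) * (ε * T) := by linear_combination T * hsq
    have h2 : 0 ≤ (1 + ε) * (ε * T) := by positivity
    exact le_of_mul_le_mul_left (by linarith : (φ + ε) * (φ * T - T - ε * T) ≤ (φ + ε) * t k)
      (by linarith)
  refine ⟨hK.trans hεK, hC.trans (Real.exp_le_exp.mpr hεK), by nlinarith, fun i => ?_,
    h.coeff_le (k + 1), fun i => ?_, s0.trans ?_, s1.trans ?_, s2.trans ?_, h.res_ne_zero k,
    h.res_ne_zero (k + 1)⟩
  · exact (h.coeff_le k i).trans (Real.exp_le_exp.mpr hup)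
  · exact (h.coeff_le (k + 2) i).trans (Real.exp_le_exp.mpr (by linarith))
  · rw [Real.exp_le_exp]
    have h1 : (2 * φ + 1 - ε) * (φ * T - T - ε * T) ≤ (2 * φ + 1 - ε) * t k := by
      gcongr; linarith
    have h2 : (2 * φ + 1 - ε) * (φ * T - T - ε * T)
        = φ * T + T - (3 * φ - ε) * (ε * T) := by linear_combination 2 * T * hsq
    have h3 : (3 * φ - ε) * (ε * T) ≤ 5 * (ε * T) := by gcongr; linarith
    linarith
  · rw [Real.exp_le_exp]
    linarith
  · rw [Real.exp_le_exp]
    have h1 : (2 * φ + 1 - ε) * ((φ - ε) * T) ≤ (2 * φ + 1 - ε) * t (k + 1 + 1) := by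
      gcongr; linarith
    have h2 : (2 * φ + 1 - ε) * ((φ - ε) * T)
        = 3 * (φ * T) + 2 * T - (3 * φ + 1 - ε) * (ε * T) := by linear_combination 2 * T * hsq
    have h3 : (3 * φ + 1 - ε) * (ε * T) ≤ 6 * (ε * T) := by gcongr; linarith
    linarith

/-- Exponential bounds for the coefficients and for the value at `ζ` of a cubic polynomial. -/
structure RowBound (ζ : ℝ) (a : Fin 4 → ℝ) (A e : ℝ) : Prop where
  coeff : ∀ i, |a i| ≤ Real.exp A
  ev : |ev4 ζ a| ≤ Real.exp e

lemma RowBound.abs_det4_le {ζ : ℝ} {a b c d : Fin 4 → ℝ} {A B C D ea eb ec ed M : ℝ}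
    (ha : RowBound ζ a A ea) (hb : RowBound ζ b B eb) (hc : RowBound ζ c C ec)
    (hd : RowBound ζ d D ed) (h1 : ea + B + C + D ≤ M) (h2 : eb + A + C + D ≤ M)
    (h3 : ec + A + B + D ≤ M) (h4 : ed + A + B + C ≤ M) :
    |det4 a b c d| ≤ 24 * Real.exp M := by
  have key : ∀ {v X Y Z E : ℝ}, |v| ≤ Real.exp E → E + X + Y + Z ≤ M →
      |v| * (Real.exp X * Real.exp Y * Real.exp Z) ≤ Real.exp M := by
    intro v X Y Z E hv hE
    calc |v| * (Real.exp X * Real.exp Y * Real.exp Z)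
        ≤ Real.exp E * (Real.exp X * Real.exp Y * Real.exp Z) := by gcongr
      _ = Real.exp (E + X + Y + Z) := by simp only [Real.exp_add]; ring
      _ ≤ _ := Real.exp_le_exp.mpr hE
  have := ExtremalCubic.abs_det4_le ζ ha.coeff hb.coeff hc.coeff hd.coeff
  linarith [key ha.ev h1, key hb.ev h2, key hc.ev h3, key hd.ev h4]

lemma mul_exp_le {c x a : ℝ} (h : c ≤ Real.exp x) : c * Real.exp a ≤ Real.exp (a + x) := by
  rw [Real.exp_add, mul_comm (Real.exp a)]
  gcongr

lemma le_mul_exp {c x a y : ℝ} (hc : 0 ≤ c) (h : c ≤ Real.exp x) (hy : y ≤ Real.exp a) :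
    c * y ≤ Real.exp (a + x) :=
  (mul_le_mul_of_nonneg_left hy hc).trans (mul_exp_le h)

lemma RowBound.low {ζ A e : ℝ} {v : Fin 3 → ℝ} (hv : ∀ i, |v i| ≤ Real.exp A)
    (he : |ev3 ζ v| ≤ Real.exp e) : RowBound ζ (low v) A e := by
  refine ⟨fun i => ?_, by rwa [ev4_low]⟩
  fin_cases i
  · exact hv 0
  · exact hv 1
  · exact hv 2
  · simpa [ExtremalCubic.low] using Real.exp_nonneg A

lemma RowBound.high {ζ A e x : ℝ} {v : Fin 3 → ℝ} (hv : ∀ i, |v i| ≤ Real.exp A)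
    (he : |ev3 ζ v| ≤ Real.exp e) (hx : |ζ| ≤ Real.exp x) : RowBound ζ (high v) A (e + x) := by
  refine ⟨fun i => ?_, ?_⟩
  · fin_cases i
    · simpa [ExtremalCubic.high] using Real.exp_nonneg A
    · exact hv 0
    · exact hv 1
    · exact hv 2
  · rw [ev4_high, abs_mul]
    exact le_mul_exp (abs_nonneg _) hx he

lemma ev4_linComb (ζ r s : ℝ) (a b : Fin 4 → ℝ) :
    ev4 ζ (fun i => r * a i + s * b i) = r * ev4 ζ a + s * ev4 ζ b := by
  simp only [ev4]; ring

lemma abs_linComb_le {r s a b R A : ℝ} (hr : |r| ≤ R) (hs : |s| ≤ R) (ha : |a| ≤ A) (hb : |b| ≤ A) :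
    |r * a + s * b| ≤ 2 * (R * A) := by
  have := abs_minor_le hr ha (by rwa [abs_neg] : |-s| ≤ R) hb
  simpa using this

/-- The product of a quadratic polynomial by `ζ - X`, a cubic polynomial vanishing at `ζ`. -/
def vanish (ζ : ℝ) (v : Fin 3 → ℝ) : Fin 4 → ℝ := fun i => ζ * low v i + -1 * high v i

lemma RowBound.vanish {ζ A x e : ℝ} {v : Fin 3 → ℝ} (hv : ∀ i, |v i| ≤ Real.exp A)
    (hx : 1 + |ζ| ≤ Real.exp x) : RowBound ζ (vanish ζ v) (A + x) e := by
  have hl := (RowBound.low (ζ := ζ) (e := Real.log |ev3 ζ v| + 1) hv (by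
    rcases eq_or_ne (ev3 ζ v) 0 with h | h
    · rw [h, abs_zero]; positivity
    · rw [← Real.log_le_iff_le_exp (abs_pos.mpr h)]; linarith)).coeff
  have hh : ∀ i, |ExtremalCubic.high v i| ≤ Real.exp A := by
    intro i
    fin_cases i
    · simpa [ExtremalCubic.high] using Real.exp_nonneg A
    · exact hv 0
    · exact hv 1
    · exact hv 2
  constructor
  · intro i
    refine le_trans ?_ (mul_exp_le (a := A) hx)
    unfold ExtremalCubic.vanish
    refine (abs_add_le _ _).trans ?_
    rw [abs_mul, abs_mul, abs_neg, abs_one, one_mul, add_mul, one_mul, add_comm]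
    exact add_le_add (hh i) (mul_le_mul_of_nonneg_left (hl i) (abs_nonneg _))
  · unfold ExtremalCubic.vanish
    rw [ev4_linComb, ev4_low, ev4_high]
    have : ζ * ev3 ζ v + -1 * (ζ * ev3 ζ v) = 0 := by ring
    rw [this, abs_zero]
    positivity

section

variable {R : Type*} [CommRing R]

lemma res_symm (a b : Fin 3 → R) : res a b = res b a := by
  simp only [res_eq_cross]; simp [cross]; ring

lemma det4_linComb_fst (r s : R) (a b c d e : Fin 4 → R) :
    det4 (fun i => r * a i + s * b i) c d e = r * det4 a c d e + s * det4 b c d e := by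
  simp [det4, det3]; ring

lemma det4_linComb_snd (r s : R) (a b c d e : Fin 4 → R) :
    det4 c (fun i => r * a i + s * b i) d e = r * det4 c a d e + s * det4 c b d e := by
  simp [det4, det3]; ring

lemma det4_plucker (a b c d w y : Fin 4 → R) :
    det4 a b c d * det4 w y c d = det4 y b c d * det4 w a c d + det4 a y c d * det4 w b c d := by
  have h1 : det4 w (fun i => det4 a b c d * y i) c d = det4 a b c d * det4 w y c d := by
    simp [det4, det3]; ring
  have h2 := det4_add_smul_snd w a b c d c d (det4 y b c d) (det4 a y c d) (det4 a b y d)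
    (det4 a b c y)
  have h3 : det4 w c c d = 0 := by simp [det4, det3]; ring
  have h4 : det4 w d c d = 0 := by simp [det4, det3]; ring
  rw [← h1, funext (det4_cramer a b c d y), h2, h3, h4]
  ring

end

lemma det4_vanish (ζ : ℝ) (a b d : Fin 3 → ℝ) :
    det4 (vanish ζ a) (vanish ζ d) (low b) (high b) = ev3 ζ b * det3 a d b := by
  simp [det4, det3, vanish, low, high, ev3]; ring

lemma quad_ne_zero {a b : Fin 3 → ℤ} (h : res a b ≠ 0) {q p : ℤ} (hqp : q ≠ 0 ∨ p ≠ 0) :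
    a 0 * q ^ 2 + a 1 * (q * p) + a 2 * p ^ 2 ≠ 0 ∨
      b 0 * q ^ 2 + b 1 * (q * p) + b 2 * p ^ 2 ≠ 0 := by
  by_contra! hab
  obtain ⟨ha, hb⟩ := hab
  rw [res_eq_cross] at h
  have h01 : cross a b 0 * (q * p) = cross a b 1 * q ^ 2 := by
    simp [cross]; linear_combination b 2 * ha - a 2 * hb
  have h12 : cross a b 1 * p ^ 2 = cross a b 2 * (q * p) := by
    simp [cross]; linear_combination b 0 * ha - a 0 * hb
  have h02 : cross a b 0 * p ^ 2 = cross a b 2 * q ^ 2 := by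
    simp [cross]; linear_combination a 1 * hb - b 1 * ha
  rcases hqp with hq | hp
  · have : (cross a b 1 ^ 2 - cross a b 0 * cross a b 2) * (q ^ 2 * q ^ 2) = 0 := by
      linear_combination (-(cross a b 0) * (q * p) - cross a b 1 * q ^ 2) * h01
        + cross a b 0 * q ^ 2 * h02
    exact h ((mul_eq_zero.mp this).resolve_right (by positivity))
  · have : (cross a b 1 ^ 2 - cross a b 0 * cross a b 2) * (p ^ 2 * p ^ 2) = 0 := by
      linear_combination (cross a b 1 * p ^ 2 + cross a b 2 * (q * p)) * h12
        - cross a b 2 * p ^ 2 * h02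
    exact h ((mul_eq_zero.mp this).resolve_right (by positivity))

/-- The number `ζ` has no rational approximation essentially better than with exponent
`1 + δ`, in logarithmic scale. -/
def IsBadlyApprox (ζ δ : ℝ) : Prop :=
  ∃ s₀ : ℝ, ∀ s, s₀ ≤ s → ∀ q p : ℤ, (q ≠ 0 ∨ p ≠ 0) → |(q : ℝ)| ≤ Real.exp s →
    |(p : ℝ)| ≤ Real.exp s → Real.exp (-((1 + δ) * s)) ≤ |ζ * q - p|

lemma abs_quad_le {ζ s r T e x M : ℝ} {v : Fin 3 → ℤ} {q p : ℤ}
    (hv : ∀ i, |castVec v i| ≤ Real.exp T) (he : absEv ζ v ≤ Real.exp e)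
    (hx : 2 + |ζ| ≤ Real.exp x) (hq : |(q : ℝ)| ≤ Real.exp s) (hp : |(p : ℝ)| ≤ Real.exp s)
    (hr : |ζ * q - p| ≤ Real.exp r) (h1 : 2 * s + e ≤ M) (h2 : T + s + r + x ≤ M) :
    |((v 0 * q ^ 2 + v 1 * (q * p) + v 2 * p ^ 2 : ℤ) : ℝ)| ≤ 2 * Real.exp M := by
  have e1 : ((v 0 * q ^ 2 + v 1 * (q * p) + v 2 * p ^ 2 : ℤ) : ℝ)
      = q ^ 2 * ev3 ζ (castVec v) - (ζ * q - p) * (v 1 * q + v 2 * (p + ζ * q)) := by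
    simp only [ev3, castVec]; push_cast; ring
  have b1 : |(q : ℝ) ^ 2 * ev3 ζ (castVec v)| ≤ Real.exp M := by
    rw [abs_mul, abs_pow]
    calc _ ≤ Real.exp s ^ 2 * Real.exp e := by gcongr
      _ = Real.exp (2 * s + e) := by rw [Real.exp_add, two_mul, Real.exp_add, sq]
      _ ≤ _ := Real.exp_le_exp.mpr h1
  have b2 : |(v 1 : ℝ) * q + v 2 * (p + ζ * q)| ≤ (2 + |ζ|) * Real.exp (T + s) := by
    have c1 : |(v 1 : ℝ) * q| ≤ Real.exp T * Real.exp s := by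
      rw [abs_mul]; exact mul_le_mul (hv 1) hq (abs_nonneg _) (by positivity)
    have c2 : |(p : ℝ) + ζ * q| ≤ Real.exp s + |ζ| * Real.exp s := by
      refine (abs_add_le _ _).trans (add_le_add hp ?_)
      rw [abs_mul]; gcongr
    have c3 : |(v 2 : ℝ) * (p + ζ * q)| ≤ Real.exp T * (Real.exp s + |ζ| * Real.exp s) := by
      rw [abs_mul]; exact mul_le_mul (hv 2) c2 (abs_nonneg _) (by positivity)
    refine (abs_add_le _ _).trans ?_
    rw [Real.exp_add]
    linarith
  have b3 : |(ζ * q - p) * (v 1 * q + v 2 * (p + ζ * q))| ≤ Real.exp M := by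
    rw [abs_mul]
    calc _ ≤ Real.exp r * Real.exp (T + s + x) :=
          mul_le_mul hr (b2.trans (mul_exp_le hx)) (abs_nonneg _) (by positivity)
      _ = Real.exp (T + s + r + x) := by rw [← Real.exp_add]; ring_nf
      _ ≤ _ := Real.exp_le_exp.mpr h2
  rw [e1]
  refine (abs_sub _ _).trans ?_
  linarith

lemma IsTriple.const_le {ζ T x : ℝ} {A B D : Fin 3 → ℤ} (h : IsTriple ζ T x A B D) :
    1000 + |ζ| ≤ Real.exp x ∧ 1000 * (1 + |ζ|) ≤ Real.exp x := by
  have hz := abs_nonneg ζ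
  have : 1000 * (1 + |ζ|) ≤ 1000 * (1 + |ζ|) ^ 3 := by
    gcongr
    exact le_self_pow₀ (by linarith) (by norm_num)
  constructor <;> linarith [h.const]

lemma exists_const (ζ ε s : ℝ) (hε : 0 < ε) : ∃ K, 1 ≤ K ∧ 1 ≤ ε * K ∧ s ≤ ε * K ∧
    1000 * (1 + |ζ|) ^ 3 ≤ Real.exp (ε * K) := by
  set m := max (max 1 s) (Real.log (1000 * (1 + |ζ|) ^ 3)) with hm
  have h1 : 1 ≤ m := (le_max_left _ _).trans (le_max_left _ _)
  have h2 : s ≤ m := (le_max_right _ _).trans (le_max_left _ _)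
  have h3 : Real.log (1000 * (1 + |ζ|) ^ 3) ≤ m := le_max_right _ _
  have key : m ≤ ε * max 1 (m / ε) := by
    calc m = ε * (m / ε) := by field_simp
      _ ≤ _ := by gcongr; exact le_max_right _ _
  refine ⟨max 1 (m / ε), le_max_left _ _, h1.trans key, h2.trans key, ?_⟩
  rw [← Real.log_le_iff_le_exp (by positivity)]
  exact h3.trans key

/-- Parameters for a good sequence together with bounds on all its triples. -/
lemma exists_isGoodSeq_isTriple {ζ : ℝ} (hζ : IsExtremal ζ) {ε : ℝ} (hε : 0 < ε)
    (hε1 : ε ≤ 1 / 100) (s : ℝ) : ∃ (Q : ℕ → Fin 3 → ℤ) (t : ℕ → ℝ),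
      (∀ k, IsTriple ζ (t (k + 1)) (ε * t (k + 1)) (Q k) (Q (k + 1)) (Q (k + 2))) ∧
      (∀ k, s ≤ ε * t k) ∧
      (∀ k, t (k + 1) ≤ (Real.goldenRatio + ε) * t k) ∧
      ∀ (S : ℝ) (k₀ : ℕ), t k₀ < S → ∃ k, k₀ ≤ k ∧ t k < S ∧ S ≤ t (k + 1) := by
  obtain ⟨K, hK1, hK2, hK3, hK4⟩ := exists_const ζ ε s hε
  obtain ⟨Q, t, h⟩ := exists_isGoodSeq hζ hε (by linarith) K
  exact ⟨Q, t, h.isTriple hε hε1 hK2 hK4, fun k => hK3.trans (by have := h.le_t k; gcongr),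
    h.upper, fun S k₀ hS => h.exists_index hε1 hK1 hS⟩

lemma isBadlyApprox_weak {ζ : ℝ} (hζ : IsExtremal ζ) : IsBadlyApprox ζ 1.3 := by
  obtain ⟨Q, t, htri, -, hup, hidx⟩ := exists_isGoodSeq_isTriple hζ (ε := 1 / 100) (by norm_num)
    le_rfl 0
  refine ⟨max 210 (2.1 * (t 0 + 1)), fun s hs q p hqp hq hp => ?_⟩
  have hs1 : 210 ≤ s := (le_max_left _ _).trans hs
  have hs2 : 2.1 * (t 0 + 1) ≤ s := (le_max_right _ _).trans hs
  obtain ⟨k, -, hk1, hk2⟩ := hidx (s / 2.1) 0 (by rw [lt_div_iff₀ (by norm_num)]; linarith)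
  rw [lt_div_iff₀ (by norm_num)] at hk1
  rw [div_le_iff₀ (by norm_num)] at hk2
  have ht := htri k
  have hu := hup k
  have hg := goldenRatio_bounds
  set T := t (k + 1)
  have hT : T * 2.1 ≤ 1.6281 * s := by
    have h1 := mul_le_mul_of_nonneg_left hk1.le (by linarith : 0 ≤ Real.goldenRatio + 1 / 100)
    have h2 := mul_le_mul_of_nonneg_right (by linarith : Real.goldenRatio + 1 / 100 ≤ 1.6281)
      (by linarith : 0 ≤ s)
    linarith
  have hT0 : 0 < T := by linarith
  have hF1 : 1.618 * T ≤ Real.goldenRatio * T := by have := hg.1; gcongr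
  have hF2 : Real.goldenRatio * T ≤ 1.6181 * T := by have := hg.2; gcongr
  by_contra! hlt
  have hx : 2 + |ζ| ≤ Real.exp (1 / 100 * T) := by linarith [ht.const_le.1]
  have he := Real.exp_neg_one_lt_d9
  rcases quad_ne_zero ht.res_right hqp with h | h
  · have := abs_quad_le ht.coeff_mid ht.ev_mid hx hq hp hlt.le (M := -1) (by linarith) (by linarith)
    linarith [one_le_abs_cast h]
  · have := abs_quad_le ht.coeff_right ht.ev_right hx hq hp hlt.le (M := -1)
      (by linarith) (by linarith)
    linarith [one_le_abs_cast h]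

lemma castVec_linComb {n : ℕ} (q p : ℤ) (a b : Fin n → ℤ) :
    castVec (fun i => q * a i + p * b i) = fun i => (q : ℝ) * castVec a i + p * castVec b i := by
  funext i; simp [castVec]

lemma IsTriple.abs_le_exp {ζ T x : ℝ} {A B D : Fin 3 → ℤ} (h : IsTriple ζ T x A B D) :
    |ζ| ≤ Real.exp x ∧ 1 + |ζ| ≤ Real.exp x := by
  constructor <;> linarith [h.const_le.1]

lemma IsTriple.exists_reduction {ζ T x s r M : ℝ} {A B D : Fin 3 → ℤ}
    (h : IsTriple ζ T x A B D) {q p : ℤ} (hqp : q ≠ 0 ∨ p ≠ 0) (hq : |(q : ℝ)| ≤ Real.exp s)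
    (hp : |(p : ℝ)| ≤ Real.exp s) (hr : |ζ * q - p| ≤ Real.exp (-r)) (hTs : T ≤ s) (hsr : s ≤ r)
    (hM1 : T - r + 9 * x ≤ M) (hM2 : s - 2 * (Real.goldenRatio * T) - T + 9 * x ≤ M) :
    ∃ q' p' : ℤ, (q' ≠ 0 ∨ p' ≠ 0) ∧ |(q' : ℝ)| ≤ Real.exp (s - T + 10 * x) ∧
      |(p' : ℝ)| ≤ Real.exp (s - T + 10 * x) ∧ |ζ * q' - p'| ≤ Real.exp M := by
  obtain ⟨hc1, hc2⟩ := h.abs_le_exp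
  have h24 : 24 ≤ Real.exp x := by linarith [h.const_le.1, abs_nonneg ζ]
  have hx0 := h.pos
  have hxT := h.small
  have hg := goldenRatio_bounds
  have hF1 : 1.618 * T ≤ Real.goldenRatio * T := by
    have := hg.1
    have : 0 ≤ T := by linarith
    gcongr
  set F := Real.goldenRatio * T
  set w : Fin 4 → ℤ := fun i => q * high A i + -p * low A i with hw
  have hlA := RowBound.low h.coeff_left h.ev_left
  have hhA := RowBound.high h.coeff_left h.ev_left hc1
  have hlB := RowBound.low h.coeff_mid h.ev_mid
  have hhB := RowBound.high h.coeff_mid h.ev_mid hc1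
  have hlD := RowBound.low h.coeff_right h.ev_right
  have hhD := RowBound.high h.coeff_right h.ev_right hc1
  have hvD : RowBound ζ (vanish ζ (castVec D)) (F + x + x) (-10 * F) :=
    RowBound.vanish h.coeff_right hc2
  have hwc : castVec w = fun i => (q : ℝ) * high (castVec A) i + (-p : ℝ) * low (castVec A) i := by
    rw [hw, castVec_linComb, castVec_high, castVec_low]; push_cast; rfl
  have hrw : RowBound ζ (castVec w) (s + F - T + 2 * x) (-r - F - T + 5 * x) := by
    constructor
    · intro i
      rw [hwc]
      refine (abs_linComb_le hq (by rwa [abs_neg]) (hhA.coeff i) (hlA.coeff i)).trans ?_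
      rw [← Real.exp_add]
      refine (mul_exp_le (x := x) (by linarith)).trans (Real.exp_le_exp.mpr (by linarith))
    · rw [hwc, ev4_linComb, ev4_high, ev4_low]
      have : (q : ℝ) * (ζ * ev3 ζ (castVec A)) + -p * ev3 ζ (castVec A)
        = (ζ * q - p) * ev3 ζ (castVec A) := by ring
      rw [this, abs_mul]
      calc _ ≤ Real.exp (-r) * Real.exp (-F - T + 5 * x) :=
            mul_le_mul hr h.ev_left (abs_nonneg _) (by positivity)
        _ = _ := by rw [← Real.exp_add]; ring_nf
  refine ⟨det4 w (low D) (low B) (high B), det4 w (high D) (low B) (high B), ?_, ?_, ?_, ?_⟩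
  · by_contra! h0
    have hres : det4 (low D) (high D) (low B) (high B) ≠ 0 := by
      have := h.res_right
      rwa [res_symm] at this
    have hz : ∀ y, det4 w y (low B) (high B) = 0 := by
      intro y
      have := det4_plucker (low D) (high D) (low B) (high B) w y
      rw [h0.1, h0.2, mul_zero, mul_zero, add_zero] at this
      exact (mul_eq_zero.mp this).resolve_left hres
    have e1 : det4 w (low A) (low B) (high B) = -(q * res A B) := by
      rw [hw, det4_linComb_fst]; simp only [res, det4, det3, Matrix.cons_val]; ring
    have e2 : det4 w (high A) (low B) (high B) = -(p * res A B) := by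
      rw [hw, det4_linComb_fst]; simp only [res, det4, det3, Matrix.cons_val]; ring
    rw [hz, eq_comm, neg_eq_zero] at e1 e2
    have := (mul_eq_zero.mp e1).resolve_right h.res_left
    have := (mul_eq_zero.mp e2).resolve_right h.res_left
    tauto
  · rw [det4_cast, castVec_low, castVec_low, castVec_high]
    refine (hrw.abs_det4_le hlD hlB hhB (M := s - T + 9 * x) ?_ ?_ ?_ ?_).trans
      ((mul_exp_le h24).trans (Real.exp_le_exp.mpr ?_)) <;> linarith
  · rw [det4_cast, castVec_low, castVec_high, castVec_high]
    refine (hrw.abs_det4_le hhD hlB hhB (M := s - T + 9 * x) ?_ ?_ ?_ ?_).trans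
      ((mul_exp_le h24).trans (Real.exp_le_exp.mpr ?_)) <;> linarith
  · rw [det4_cast, det4_cast, castVec_low, castVec_low, castVec_high, castVec_high]
    have e1 : ζ * det4 (castVec w) (low (castVec D)) (low (castVec B)) (high (castVec B))
        - det4 (castVec w) (high (castVec D)) (low (castVec B)) (high (castVec B))
        = (ζ * q - p) * det4 (low (castVec A)) (vanish ζ (castVec D)) (low (castVec B))
            (high (castVec B))
          - q * (ev3 ζ (castVec B) * det3 (castVec A) (castVec D) (castVec B)) := by
      rw [← det4_vanish, hwc]
      unfold vanish
      simp only [det4_linComb_fst, det4_linComb_snd]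
      ring
    rw [e1]
    have b1 := hlA.abs_det4_le hvD hlB hhB (M := T + 7 * x) (by linarith) (by linarith)
      (by linarith) (by linarith)
    have b2 : |(ζ * q - p) * det4 (low (castVec A)) (vanish ζ (castVec D)) (low (castVec B))
            (high (castVec B))| ≤ Real.exp (M - x) := by
      rw [abs_mul]
      calc _ ≤ Real.exp (-r) * Real.exp (T + 7 * x + x) :=
            mul_le_mul hr (b1.trans (mul_exp_le h24)) (abs_nonneg _) (by positivity)
        _ = Real.exp (-r + (T + 7 * x + x)) := (Real.exp_add _ _).symm
        _ ≤ _ := Real.exp_le_exp.mpr (by linarith)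
    have b3 : |det3 (castVec A) (castVec D) (castVec B)| ≤ Real.exp (7 * x) := by
      have c := abs_det3_le ζ h.coeff_left h.coeff_right h.coeff_mid
      have key : ∀ {v X Y E : ℝ}, |v| ≤ Real.exp E → E + X + Y ≤ 6 * x →
          |v| * (Real.exp X * Real.exp Y) ≤ Real.exp (6 * x) := by
        intro v X Y E hv hE
        calc |v| * (Real.exp X * Real.exp Y)
            ≤ Real.exp E * (Real.exp X * Real.exp Y) := by gcongr
          _ = Real.exp (E + X + Y) := by simp only [Real.exp_add]; ring
          _ ≤ _ := Real.exp_le_exp.mpr hE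
      have k1 := key (X := F + x) (Y := T) h.ev_left (by linarith)
      have k2 := key (X := F - T + x) (Y := T) h.ev_right (by linarith)
      have k3 := key (X := F - T + x) (Y := F + x) h.ev_mid (by linarith)
      have : 6 * Real.exp (6 * x) ≤ Real.exp (6 * x + x) := mul_exp_le (by linarith)
      rw [show 6 * x + x = 7 * x by ring] at this
      linarith
    have b4 : |(q : ℝ) * (ev3 ζ (castVec B) * det3 (castVec A) (castVec D) (castVec B))|
        ≤ Real.exp (M - x) := by
      rw [abs_mul, abs_mul]
      calc _ ≤ Real.exp s * (Real.exp (-2 * F - T + x) * Real.exp (7 * x)) := by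
            gcongr
            exact h.ev_mid
        _ = Real.exp (s + (-2 * F - T + x + 7 * x)) := by simp only [Real.exp_add]
        _ ≤ _ := Real.exp_le_exp.mpr (by linarith)
    have b5 : 2 * Real.exp (M - x) ≤ Real.exp (M - x + x) := mul_exp_le (by linarith)
    rw [sub_add_cancel] at b5
    refine (abs_sub _ _).trans ?_
    linarith

lemma IsBadlyApprox.improve {ζ δ : ℝ} (hζ : IsExtremal ζ) (hδ0 : 0 < δ) (hδ : δ ≤ 1.3)
    (h : IsBadlyApprox ζ δ) : IsBadlyApprox ζ (0.6 * δ) := by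
  obtain ⟨s₀, hs₀⟩ := h
  obtain ⟨Q, t, htri, hbig, hup, hidx⟩ := exists_isGoodSeq_isTriple hζ (ε := δ / 200)
    (by positivity) (by linarith) s₀
  refine ⟨t 1 + 1, fun s hs q p hqp hq hp => ?_⟩
  obtain ⟨k, hk0, hk1, hk2⟩ := hidx s 1 (by linarith)
  obtain ⟨k, rfl⟩ : ∃ k', k = k' + 1 := ⟨k - 1, by omega⟩
  have ht := htri k
  have hb := hbig (k + 1)
  have hsF := hk2.trans (hup (k + 1))
  have hg := goldenRatio_bounds
  have hpos := ht.pos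
  have hsmall := ht.small
  set T := t (k + 1)
  have hT0 : 0 < T := by linarith
  have hF1 : 1.618 * T ≤ Real.goldenRatio * T := by have := hg.1; gcongr
  have hF2 : Real.goldenRatio * T ≤ 1.6181 * T := by have := hg.2; gcongr
  by_contra! hlt
  have hδs : 0 ≤ δ * s := mul_nonneg hδ0.le (by linarith)
  set x := δ / 200 * T with hx
  set M := max (T - (1 + 0.6 * δ) * s + 9 * x) (s - 2 * (Real.goldenRatio * T) - T + 9 * x)
    with hM
  obtain ⟨q', p', hne, hq', hp', hlt'⟩ := ht.exists_reduction hqp hq hp hlt.le hk1.le (by linarith)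
    (le_max_left _ _) (le_max_right _ _)
  have hfin := (hs₀ _ (by linarith) q' p' hne hq' hp').trans hlt'
  rw [Real.exp_le_exp] at hfin
  have hδx : δ * x ≤ 1.3 * x := by gcongr
  have hsT : s ≤ 1.6281 * T := by linarith
  rcases le_max_iff.mp hfin with hfin | hfin
  · have h1 : δ * s ≤ δ * (1.6281 * T) := by gcongr
    nlinarith [mul_pos hδ0 hT0]
  · have h1 : δ * (s - T) ≤ 1.3 * (s - T) := by gcongr
    nlinarith [mul_pos hδ0 hT0]

theorem isBadlyApprox {ζ : ℝ} (hζ : IsExtremal ζ) {δ : ℝ} (hδ : 0 < δ) : IsBadlyApprox ζ δ := by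
  have key : ∀ n : ℕ, IsBadlyApprox ζ (0.6 ^ n * 1.3) := by
    intro n
    induction n with
    | zero => simpa using isBadlyApprox_weak hζ
    | succ n ih =>
      rw [pow_succ', mul_assoc]
      refine ih.improve hζ (by positivity) ?_
      exact mul_le_of_le_one_left (by norm_num) (pow_le_one₀ (by norm_num) (by norm_num))
  obtain ⟨n, hn⟩ := exists_pow_lt_of_lt_one (show 0 < δ / 1.3 by positivity)
    (show (0.6 : ℝ) < 1 by norm_num)
  rw [lt_div_iff₀ (by norm_num)] at hn
  obtain ⟨s₀, h⟩ := key n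
  refine ⟨max s₀ 0, fun s hs q p hqp hq hp => ?_⟩
  refine le_trans (Real.exp_le_exp.mpr ?_) (h s ((le_max_left _ _).trans hs) q p hqp hq hp)
  have : 0 ≤ s := (le_max_right _ _).trans hs
  have := mul_le_mul_of_nonneg_right hn.le this
  linarith

lemma IsTriple.abs_res_le {ζ T x : ℝ} {A B D : Fin 3 → ℤ} (h : IsTriple ζ T x A B D) :
    |((res B D : ℤ) : ℝ)| ≤ absEv ζ B * Real.exp (T + 2 * (Real.goldenRatio * T) + 3 * x) := by
  obtain ⟨hc1, -⟩ := h.abs_le_exp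
  have hc3 := h.const_le.2
  have hx0 := h.pos
  have hxT := h.small
  have hg := goldenRatio_bounds
  have hF1 : 1.618 * T ≤ Real.goldenRatio * T := by
    have := hg.1
    have : 0 ≤ T := by linarith
    gcongr
  have hlB := RowBound.low h.coeff_mid h.ev_mid
  have hhB := RowBound.high h.coeff_mid h.ev_mid hc1
  have hlD := RowBound.low h.coeff_right h.ev_right
  have hhD := RowBound.high h.coeff_right h.ev_right hc1
  have h1 := one_le_abs_cast h.res_right
  have key := abs_det4_le ζ hlB.coeff hhB.coeff hlD.coeff hhD.coeff
  rw [← castVec_low, ← castVec_high, ← castVec_low, ← castVec_high, ← det4_cast, castVec_low,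
    castVec_high, castVec_low, castVec_high, ev4_high, ev4_high, ev4_low,
    ev4_low, abs_mul, abs_mul] at key
  set F := Real.goldenRatio * T
  have hD : |ev3 ζ (castVec D)| ≤ Real.exp (-3 * F - 2 * T + 6 * x) := h.ev_right
  have e1 : Real.exp T * Real.exp (F + x) * Real.exp (F + x)
      = Real.exp (T + 2 * F + 2 * x) := by
    simp only [← Real.exp_add]; ring_nf
  have e2 : Real.exp T * Real.exp T * Real.exp (F + x) = Real.exp (2 * T + F + x) := by
    simp only [← Real.exp_add]; ring_nf
  rw [e1, e2] at key
  have b1 : |ev3 ζ (castVec D)| * Real.exp (2 * T + F + x) ≤ Real.exp (-2 * x) := by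
    calc _ ≤ Real.exp (-3 * F - 2 * T + 6 * x) * Real.exp (2 * T + F + x) := by gcongr
      _ = Real.exp (-3 * F - 2 * T + 6 * x + (2 * T + F + x)) := (Real.exp_add _ _).symm
      _ ≤ _ := Real.exp_le_exp.mpr (by linarith)
  have b2 : 1000 * (1 + |ζ|) * Real.exp (-2 * x) ≤ Real.exp (-2 * x + x) := mul_exp_le hc3
  have b3 : Real.exp (-2 * x + x) ≤ 1 := Real.exp_le_one_iff.mpr (by linarith)
  have b4 := mul_le_mul_of_nonneg_left b1 (by positivity : 0 ≤ 1 + |ζ|)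
  have b5 : 1000 * (1 + |ζ|) * Real.exp (T + 2 * F + 2 * x) ≤
      Real.exp (T + 2 * F + 2 * x + x) := mul_exp_le hc3
  have b6 := mul_le_mul_of_nonneg_left b5 (abs_nonneg (ev3 ζ (castVec B)))
  rw [show T + 2 * F + 3 * x = T + 2 * F + 2 * x + x by ring]
  have b7 : 0 ≤ |ev3 ζ (castVec B)| * Real.exp (T + 2 * F + 2 * x + x) := by positivity
  change |((det4 (low B) (high B) (low D) (high D) : ℤ) : ℝ)| ≤ _
  change 1 ≤ |((det4 (low B) (high B) (low D) (high D) : ℤ) : ℝ)| at h1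
  change _ ≤ |ev3 ζ (castVec B)| * _
  linarith

/-- A cubic polynomial with a small value at `ζ` is a combination of the two multiples of `B`,
and gives rise to a good rational approximation of `ζ`. -/
lemma IsTriple.exists_approx_of_cubic {ζ T x s r M : ℝ} {A B D : Fin 3 → ℤ}
    (h : IsTriple ζ T x A B D) {P : Fin 4 → ℤ} (hP : ∀ i, |castVec P i| ≤ Real.exp s)
    (hP0 : ev4 ζ (castVec P) ≠ 0) (hr : |ev4 ζ (castVec P)| ≤ Real.exp (-r))
    (hs : s ≤ Real.goldenRatio * T - 4 * x) (hrT : 2 * T + Real.goldenRatio * T + 2 * x ≤ r)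
    (hM1 : T + 2 * (Real.goldenRatio * T) - r + 2 * x ≤ M) (hM2 : s - T + 8 * x ≤ M) :
    ∃ q p : ℤ, (q ≠ 0 ∨ p ≠ 0) ∧ |(q : ℝ)| ≤ Real.exp (M + x) ∧ |(p : ℝ)| ≤ Real.exp (M + x) ∧
      |ζ * q - p| ≤ Real.exp (T + 2 * (Real.goldenRatio * T) - r + 3 * x) := by
  obtain ⟨hc1, -⟩ := h.abs_le_exp
  have hc : 1000 ≤ Real.exp x := by linarith [h.const_le.1, abs_nonneg ζ]
  have h24 : 24 ≤ Real.exp x := by linarith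
  have hres := h.abs_res_le
  have hx0 := h.pos
  have hxT := h.small
  have hg := goldenRatio_bounds
  have hF1 : 1.618 * T ≤ Real.goldenRatio * T := by
    have := hg.1
    have : 0 ≤ T := by linarith
    gcongr
  set F := Real.goldenRatio * T
  have hlB := RowBound.low h.coeff_mid h.ev_mid
  have hhB := RowBound.high h.coeff_mid h.ev_mid hc1
  have hlD := RowBound.low h.coeff_right h.ev_right
  have hhD := RowBound.high h.coeff_right h.ev_right hc1
  have hrP : RowBound ζ (castVec P) s (-r) := ⟨hP, hr⟩
  have hsmall : ∀ n : ℤ, |(n : ℝ)| ≤ 24 * Real.exp (-x) → n = 0 := by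
    intro n hn
    by_contra h0
    have h2 : 24 * Real.exp (-x) < 1000 * Real.exp (-x) := by gcongr; norm_num
    have h3 := mul_exp_le (a := -x) hc
    rw [neg_add_cancel, Real.exp_zero] at h3
    linarith [one_le_abs_cast h0]
  have hz1 : det4 (low B) (high B) P (high D) = 0 := by
    apply hsmall
    rw [det4_cast, castVec_low, castVec_high, castVec_high]
    apply hlB.abs_det4_le hhB hrP hhD <;> linarith
  have hz2 : det4 (low B) (high B) (low D) P = 0 := by
    apply hsmall
    rw [det4_cast, castVec_low, castVec_high, castVec_low]
    apply hlB.abs_det4_le hhB hlD hrP <;> linarith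
  have hcr : ∀ i, res B D * P i = det4 P (high B) (low D) (high D) * low B i
      + det4 (low B) P (low D) (high D) * high B i := by
    intro i
    have := det4_cramer (low B) (high B) (low D) (high D) P i
    rw [hz1, hz2] at this
    rw [res, this]; ring
  have hev : ((res B D : ℤ) : ℝ) * ev4 ζ (castVec P)
      = ev3 ζ (castVec B) * (ζ * (det4 (low B) P (low D) (high D) : ℤ)
        - (-det4 P (high B) (low D) (high D) : ℤ)) := by
    have e := ev4_linComb ζ (det4 P (high B) (low D) (high D) : ℤ)
      (det4 (low B) P (low D) (high D) : ℤ) (castVec (low B)) (castVec (high B))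
    rw [← castVec_linComb, ← funext hcr] at e
    rw [castVec_low B, castVec_high B, ev4_high, ev4_low] at e
    have e' : ev4 ζ (castVec fun i => res B D * P i)
        = ((res B D : ℤ) : ℝ) * ev4 ζ (castVec P) := by
      simp only [ev4, castVec]; push_cast; ring
    rw [← e', e]; push_cast; ring
  refine ⟨det4 (low B) P (low D) (high D), -det4 P (high B) (low D) (high D), ?_, ?_, ?_, ?_⟩
  · by_contra! h0
    rw [h0.1, h0.2] at hev
    have := mul_ne_zero (Int.cast_ne_zero (α := ℝ).mpr h.res_right) hP0
    apply this
    rw [hev]; simp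
  · rw [det4_cast, castVec_low, castVec_low, castVec_high]
    refine (hlB.abs_det4_le hrP hlD hhD (M := M) ?_ ?_ ?_ ?_).trans (mul_exp_le h24) <;> linarith
  · push_cast
    rw [abs_neg, det4_cast, castVec_low, castVec_high, castVec_high]
    refine (hrP.abs_det4_le hhB hlD hhD (M := M) ?_ ?_ ?_ ?_).trans (mul_exp_le h24) <;> linarith
  · have hB : 0 < |ev3 ζ (castVec B)| := by
      have h1 := one_le_abs_cast h.res_right
      by_contra! h0
      have : absEv ζ B ≤ 0 := h0
      have h2 : absEv ζ B * Real.exp (T + 2 * F + 3 * x) ≤ 0 :=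
        mul_nonpos_of_nonpos_of_nonneg this (by positivity)
      linarith
    refine le_of_mul_le_mul_left ?_ hB
    rw [← abs_mul, ← hev, abs_mul]
    calc _ ≤ (absEv ζ B * Real.exp (T + 2 * F + 3 * x)) * Real.exp (-r) := by gcongr
      _ = |ev3 ζ (castVec B)| * Real.exp (T + 2 * F + 3 * x + -r) := by
        rw [Real.exp_add _ (-r), mul_assoc]
      _ = _ := by ring_nf

theorem cubic_lower_bound {ζ : ℝ} (hζ : IsExtremal ζ) {δ : ℝ} (hδ0 : 0 < δ) (hδ1 : δ ≤ 1) :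
    ∃ s₀ : ℝ, ∀ s, s₀ ≤ s → ∀ P : Fin 4 → ℤ, P ≠ 0 → (∀ i, |castVec P i| ≤ Real.exp s) →
      Real.exp (-((2 * Real.goldenRatio + 1 + δ) * s)) < |ev4 ζ (castVec P)| := by
  obtain ⟨s₀, hs₀⟩ := isBadlyApprox hζ (δ := δ / 10) (by positivity)
  obtain ⟨Q, t, htri, hbig, hup, hidx⟩ := exists_isGoodSeq_isTriple hζ (ε := δ / 1000)
    (by positivity) (by linarith) s₀
  refine ⟨max 1 (t 1 + 1), fun s hs P hP0 hP => ?_⟩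
  have hs1 : 1 ≤ s := (le_max_left _ _).trans hs
  have hs2 : t 1 + 1 ≤ s := (le_max_right _ _).trans hs
  have hδs : 0 < δ * s := by positivity
  obtain ⟨k, hk0, hk1, hk2⟩ := hidx (s + δ * s / 100) 1 (by linarith)
  obtain ⟨k, rfl⟩ : ∃ k', k = k' + 1 := ⟨k - 1, by omega⟩
  have ht := htri k
  have hb := hbig (k + 1)
  have hsF := hk2.trans (hup (k + 1))
  have hg := goldenRatio_bounds
  have hpos := ht.pos
  have hsmall := ht.small
  set T := t (k + 1)
  have hT0 : 0 < T := by linarith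
  have hF1 : 1.618 * T ≤ Real.goldenRatio * T := by have := hg.1; gcongr
  have hF2 : Real.goldenRatio * T ≤ 1.6181 * T := by have := hg.2; gcongr
  by_contra! hlt
  have hδs1 : δ * s ≤ s := mul_le_of_le_one_left (by linarith) hδ1
  set x := δ / 1000 * T with hx
  set F := Real.goldenRatio * T with hF
  have hδT1 : δ * T ≤ T := mul_le_of_le_one_left hT0.le hδ1
  have hsT : s ≤ 1.7 * T := by linarith
  have hTs : T ≤ 1.01 * s := by linarith
  have hδ2 : δ * s ≤ δ * (1.7 * T) := by gcongr
  have hδ3 : δ * T ≤ δ * (1.01 * s) := by gcongr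
  have hφs : 2 * Real.goldenRatio * (T - 17 * x) ≤ 2 * Real.goldenRatio * s := by
    gcongr; linarith
  have hφx : Real.goldenRatio * x ≤ 1.6181 * x := by have := hg.2; gcongr
  obtain ⟨q, p, hne, hq, hp, hap⟩ := ht.exists_approx_of_cubic hP
    (ev4_ne_zero hζ.1 hP0) hlt (M := s - T + 97 * x) (by linarith) (by linarith) (by linarith)
    (by linarith)
  have hfin := (hs₀ _ (by linarith) q p hne hq hp).trans hap
  rw [Real.exp_le_exp] at hfin
  have h1 : δ * (s - T + 97 * x + x) ≤ δ * T := by gcongr; linarith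
  linarith

lemma det4_pairing {R : Type*} [CommRing R] (a b c d y : Fin 4 → R) (i : Fin 4) :
    det4 a b c d * y i = det4 (Pi.single i 1) b c d * (a ⬝ᵥ y)
      + det4 a (Pi.single i 1) c d * (b ⬝ᵥ y) + det4 a b (Pi.single i 1) d * (c ⬝ᵥ y)
      + det4 a b c (Pi.single i 1) * (d ⬝ᵥ y) := by
  have h : det4 a b c d * y i
      = ∑ j, (det4 a b c d * (Pi.single i 1 : Fin 4 → R) j) * y j := by
    simp [Pi.single_apply]
  rw [h]
  simp only [det4_cramer a b c d (Pi.single i 1), dotProduct, Finset.mul_sum,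
    ← Finset.sum_add_distrib]
  exact Finset.sum_congr rfl fun j _ => by ring

/-- If the resultant does not vanish, then no nonzero vector is orthogonal to the four shifts. -/
lemma exists_pairing_ne_zero {a b : Fin 3 → ℤ} (h : res a b ≠ 0) {y : Fin 4 → ℤ} (hy : y ≠ 0)
    (h1 : low b ⬝ᵥ y = 0) (h2 : high b ⬝ᵥ y = 0) : low a ⬝ᵥ y ≠ 0 ∨ high a ⬝ᵥ y ≠ 0 := by
  by_contra! h0
  apply hy
  funext i
  have := det4_pairing (low a) (high a) (low b) (high b) y i
  rw [h0.1, h0.2, h1, h2] at this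
  simp only [mul_zero, add_zero] at this
  exact (mul_eq_zero.mp this).resolve_left h

lemma low_dotProduct {R : Type*} [CommRing R] (v : Fin 3 → R) (y : Fin 4 → R) :
    low v ⬝ᵥ y = v 0 * y 0 + v 1 * y 1 + v 2 * y 2 := by
  simp [dotProduct, Fin.sum_univ_four, low]

lemma high_dotProduct {R : Type*} [CommRing R] (v : Fin 3 → R) (y : Fin 4 → R) :
    high v ⬝ᵥ y = v 0 * y 1 + v 1 * y 2 + v 2 * y 3 := by
  simp [dotProduct, Fin.sum_univ_four, high]

lemma abs_sum3_le {a b c x y z A E : ℝ} (ha : |a| ≤ A) (hb : |b| ≤ A) (hc : |c| ≤ A)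
    (hx : |x| ≤ E) (hy : |y| ≤ E) (hz : |z| ≤ E) : |a * x + b * y + c * z| ≤ 3 * (A * E) := by
  have key : ∀ {u v : ℝ}, |u| ≤ A → |v| ≤ E → |u * v| ≤ A * E := fun hu hv => by
    rw [abs_mul]; exact mul_le_mul hu hv (abs_nonneg _) ((abs_nonneg _).trans hu)
  refine (abs_add_three _ _ _).trans ?_
  linarith [key ha hx, key hb hy, key hc hz]

section Pairing

variable {ζ s r Y e M : ℝ} {v : Fin 3 → ℤ} {y : Fin 4 → ℤ}

lemma abs_low_dotProduct_le (hv : ∀ i, |castVec v i| ≤ Real.exp Y) (he : absEv ζ v ≤ Real.exp e)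
    (hy : |(y 0 : ℝ)| ≤ Real.exp s)
    (hr : ∀ i : Fin 4, |ζ ^ (i : ℕ) * y 0 - y i| ≤ Real.exp (-r)) (h1 : e + s ≤ M)
    (h2 : Y - r ≤ M) : |((low v ⬝ᵥ y : ℤ) : ℝ)| ≤ 4 * Real.exp M := by
  have e1 : ((low v ⬝ᵥ y : ℤ) : ℝ) = ev3 ζ (castVec v) * y 0
      - (castVec v 0 * (ζ ^ 0 * y 0 - y 0) + castVec v 1 * (ζ ^ 1 * y 0 - y 1)
        + castVec v 2 * (ζ ^ 2 * y 0 - y 2)) := by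
    rw [low_dotProduct]; simp only [ev3, castVec]; push_cast; ring
  have b1 : |ev3 ζ (castVec v) * y 0| ≤ Real.exp M := by
    rw [abs_mul]
    calc _ ≤ Real.exp e * Real.exp s := mul_le_mul he hy (abs_nonneg _) (by positivity)
      _ = Real.exp (e + s) := (Real.exp_add _ _).symm
      _ ≤ _ := Real.exp_le_exp.mpr h1
  have b2 := abs_sum3_le (hv 0) (hv 1) (hv 2) (hr 0) (hr 1) (hr 2)
  rw [← Real.exp_add] at b2
  have b3 := Real.exp_le_exp.mpr (show Y + -r ≤ M by linarith)
  rw [e1]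
  refine (abs_sub _ _).trans ?_
  simp only [Fin.val_zero, Fin.val_one, Fin.val_two] at b2
  linarith

lemma abs_high_dotProduct_le (hv : ∀ i, |castVec v i| ≤ Real.exp Y) (he : absEv ζ v ≤ Real.exp e)
    (hy : |(y 0 : ℝ)| ≤ Real.exp s)
    (hr : ∀ i : Fin 4, |ζ ^ (i : ℕ) * y 0 - y i| ≤ Real.exp (-r)) {x : ℝ}
    (hx : |ζ| ≤ Real.exp x) (h1 : e + x + s ≤ M)
    (h2 : Y - r ≤ M) : |((high v ⬝ᵥ y : ℤ) : ℝ)| ≤ 4 * Real.exp M := by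
  have e1 : ((high v ⬝ᵥ y : ℤ) : ℝ) = ζ * ev3 ζ (castVec v) * y 0
      - (castVec v 0 * (ζ ^ 1 * y 0 - y 1) + castVec v 1 * (ζ ^ 2 * y 0 - y 2)
        + castVec v 2 * (ζ ^ 3 * y 0 - y 3)) := by
    rw [high_dotProduct]; simp only [ev3, castVec]; push_cast; ring
  have b1 : |ζ * ev3 ζ (castVec v) * y 0| ≤ Real.exp M := by
    rw [abs_mul, abs_mul]
    calc _ ≤ Real.exp (e + x) * Real.exp s :=
          mul_le_mul (le_mul_exp (abs_nonneg _) hx he) hy (abs_nonneg _) (by positivity)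
      _ = Real.exp (e + x + s) := (Real.exp_add _ _).symm
      _ ≤ _ := Real.exp_le_exp.mpr h1
  have b2 := abs_sum3_le (hv 0) (hv 1) (hv 2) (hr 1) (hr 2) (hr 3)
  rw [← Real.exp_add] at b2
  have b3 := Real.exp_le_exp.mpr (show Y + -r ≤ M by linarith)
  rw [e1]
  refine (abs_sub _ _).trans ?_
  simp only [Fin.val_one, Fin.val_two, show ((3 : Fin 4) : ℕ) = 3 from rfl] at b2
  linarith

lemma abs_shift_dotProduct_le (hv : ∀ i, |castVec v i| ≤ Real.exp Y)
    (hr : ∀ i : Fin 4, |ζ ^ (i : ℕ) * y 0 - y i| ≤ Real.exp (-r)) {x : ℝ}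
    (hx : 1000 * (1 + |ζ|) ≤ Real.exp x) :
    |ζ * ((low v ⬝ᵥ y : ℤ) : ℝ) - ((high v ⬝ᵥ y : ℤ) : ℝ)| ≤ Real.exp (Y - r + x) := by
  have e1 : ζ * ((low v ⬝ᵥ y : ℤ) : ℝ) - ((high v ⬝ᵥ y : ℤ) : ℝ)
      = (castVec v 0 * (ζ ^ 1 * y 0 - y 1) + castVec v 1 * (ζ ^ 2 * y 0 - y 2)
        + castVec v 2 * (ζ ^ 3 * y 0 - y 3))
      - ζ * (castVec v 0 * (ζ ^ 0 * y 0 - y 0) + castVec v 1 * (ζ ^ 1 * y 0 - y 1)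
        + castVec v 2 * (ζ ^ 2 * y 0 - y 2)) := by
    rw [high_dotProduct, low_dotProduct]; simp only [castVec]; push_cast; ring
  have b1 := abs_sum3_le (hv 0) (hv 1) (hv 2) (hr 1) (hr 2) (hr 3)
  have b2 := abs_sum3_le (hv 0) (hv 1) (hv 2) (hr 0) (hr 1) (hr 2)
  rw [← Real.exp_add] at b1 b2
  simp only [Fin.val_zero, Fin.val_one, Fin.val_two, show ((3 : Fin 4) : ℕ) = 3 from rfl] at b1 b2
  have b3 := mul_le_mul_of_nonneg_left b2 (abs_nonneg ζ)
  rw [← abs_mul] at b3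
  have b4 := mul_exp_le (a := Y + -r) hx
  rw [show Y - r + x = Y + -r + x by ring]
  rw [e1]
  refine (abs_sub _ _).trans ?_
  have b5 : 0 ≤ (1 + |ζ|) * Real.exp (Y + -r) := by positivity
  linarith

end Pairing

/-- A point close to the twisted cubic gives rise to a good rational approximation of `ζ`. -/
lemma IsTriple.exists_approx_of_point {ζ T x s r M : ℝ} {A B D : Fin 3 → ℤ}
    (h : IsTriple ζ T x A B D) {y : Fin 4 → ℤ} (hy0 : y ≠ 0) (hy : |(y 0 : ℝ)| ≤ Real.exp s)
    (hr : ∀ i : Fin 4, |ζ ^ (i : ℕ) * y 0 - y i| ≤ Real.exp (-r))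
    (hs : s ≤ 2 * (Real.goldenRatio * T) + T - 3 * x) (hrT : T + x ≤ r)
    (hM1 : s - Real.goldenRatio * T - T + 6 * x ≤ M) (hM2 : Real.goldenRatio * T - T + x - r ≤ M) :
    r ≤ Real.goldenRatio * T + 2 * x ∧
    ∃ q p : ℤ, (q ≠ 0 ∨ p ≠ 0) ∧ |(q : ℝ)| ≤ Real.exp (M + x) ∧ |(p : ℝ)| ≤ Real.exp (M + x) ∧
      |ζ * q - p| ≤ Real.exp (Real.goldenRatio * T - T - r + 2 * x) := by
  obtain ⟨hc1, -⟩ := h.abs_le_exp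
  have hc3 := h.const_le.2
  have hc : 1000 ≤ Real.exp x := by linarith [h.const_le.1, abs_nonneg ζ]
  have hx0 := h.pos
  have hxT := h.small
  have hg := goldenRatio_bounds
  have hF1 : 1.618 * T ≤ Real.goldenRatio * T := by
    have := hg.1
    have : 0 ≤ T := by linarith
    gcongr
  have hsmall : ∀ {n : ℤ}, |(n : ℝ)| ≤ 4 * Real.exp (-x) → n = 0 := by
    intro n hn
    by_contra h0
    have h2 : 4 * Real.exp (-x) < 1000 * Real.exp (-x) := by gcongr; norm_num
    have h3 := mul_exp_le (a := -x) hc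
    rw [neg_add_cancel, Real.exp_zero] at h3
    linarith [one_le_abs_cast h0]
  have hz1 : low B ⬝ᵥ y = 0 :=
    hsmall (abs_low_dotProduct_le h.coeff_mid h.ev_mid hy hr (by linarith) (by linarith))
  have hz2 : high B ⬝ᵥ y = 0 :=
    hsmall (abs_high_dotProduct_le h.coeff_mid h.ev_mid hy hr hc1 (by linarith) (by linarith))
  constructor
  · by_contra! hlt
    rcases exists_pairing_ne_zero (by rw [res_symm]; exact h.res_right) hy0 hz1 hz2 with h0 | h0
    · exact h0 (hsmall (abs_low_dotProduct_le h.coeff_right h.ev_right hy hr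
        (by linarith) (by linarith)))
    · exact h0 (hsmall (abs_high_dotProduct_le h.coeff_right h.ev_right hy hr hc1
        (by linarith) (by linarith)))
  · refine ⟨low A ⬝ᵥ y, high A ⬝ᵥ y, exists_pairing_ne_zero h.res_left hy0 hz1 hz2, ?_, ?_, ?_⟩
    · exact (abs_low_dotProduct_le h.coeff_left h.ev_left hy hr (by linarith) (by linarith)).trans
        (mul_exp_le (by linarith))
    · exact (abs_high_dotProduct_le h.coeff_left h.ev_left hy hr hc1 (by linarith)
        (by linarith)).trans (mul_exp_le (by linarith))
    · refine (abs_shift_dotProduct_le h.coeff_left hr hc3).trans (Real.exp_le_exp.mpr ?_)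
      linarith

theorem point_lower_bound {ζ : ℝ} (hζ : IsExtremal ζ) {c δ : ℝ}
    (hc : c * (2 * Real.goldenRatio - 1) = 1) (hδ0 : 0 < δ) (hδ1 : δ ≤ 1) :
    ∃ s₀ : ℝ, ∀ s, s₀ ≤ s → ∀ y : Fin 4 → ℤ, y ≠ 0 → |(y 0 : ℝ)| ≤ Real.exp s →
      ∃ i : Fin 4, Real.exp (-((c + δ) * s)) < |ζ ^ (i : ℕ) * y 0 - y i| := by
  obtain ⟨s₀, hs₀⟩ := isBadlyApprox hζ hδ0
  obtain ⟨Q, t, htri, hbig, hup, hidx⟩ := exists_isGoodSeq_isTriple hζ (ε := δ / 100)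
    (by positivity) (by linarith) s₀
  have hg := goldenRatio_bounds
  have hsq := Real.goldenRatio_sq
  have hc1 : 0.447 ≤ c := by nlinarith
  set φ := Real.goldenRatio
  have hu0 : 0 < 2 * φ + 1 - 3 * (δ / 100) := by linarith
  refine ⟨max 1 ((t 0 + 1) * (2 * φ + 1 - 3 * (δ / 100))), fun s hs y hy0 hy => ?_⟩
  have hs1 : 1 ≤ s := (le_max_left _ _).trans hs
  have hs2 := (le_max_right _ _).trans hs
  rw [← le_div_iff₀ hu0] at hs2
  obtain ⟨k, -, hk1, hk2⟩ := hidx (s / (2 * φ + 1 - 3 * (δ / 100))) 0 (by linarith)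
  have htT := hk1.le.trans hk2
  rw [lt_div_iff₀ hu0] at hk1
  rw [div_le_iff₀ hu0] at hk2
  have ht := htri k
  have hb := hbig (k + 1)
  have hsF := hup k
  have hpos := ht.pos
  have hsmall := ht.small
  set T := t (k + 1)
  have hT0 : 0 < T := by linarith
  have hF1 : 1.618 * T ≤ φ * T := by have := hg.1; gcongr
  have hF2 : φ * T ≤ 1.6181 * T := by have := hg.2; gcongr
  by_contra! hlt
  set x := δ / 100 * T with hx
  have hφx : φ * x ≤ 1.6181 * x := by have := hg.2; gcongr
  have hδx : δ * x ≤ x := mul_le_of_le_one_left (by linarith) hδ1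
  have htx : δ / 100 * t k ≤ x := by rw [hx]; gcongr
  have htk : φ * T - T - x ≤ t k := by
    have h1 : (φ - 1) * T ≤ (φ - 1) * ((φ + δ / 100) * t k) := by gcongr; linarith
    have h2 : (φ - 1) * ((φ + δ / 100) * t k) = t k + (φ - 1) * (δ / 100 * t k) := by
      linear_combination t k * hsq
    have h3 : (φ - 1) * (δ / 100 * t k) ≤ (φ - 1) * x := by gcongr; linarith
    linarith
  have hsl : φ * T + T - 7 * x ≤ s := by
    have h1 : (2 * φ + 1 - 3 * (δ / 100)) * (φ * T - T - x)
        ≤ (2 * φ + 1 - 3 * (δ / 100)) * t k := by gcongr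
    have h2 : (2 * φ + 1 - 3 * (δ / 100)) * (φ * T - T - x)
        = φ * T + T - 3 * (φ * x) + 3 * x - 2 * φ * x - x + 3 * (δ / 100) * x := by
      rw [hx]; linear_combination 2 * T * hsq
    have h3 : 0 ≤ 3 * (δ / 100) * x := by positivity
    linarith
  have hsu : s ≤ 2 * (φ * T) + T - 3 * x := by rw [hx]; linarith
  have hrs : 0.447 * s ≤ (c + δ) * s := by gcongr; linarith
  obtain ⟨hrF, q, p, hne, hq, hp, hap⟩ := ht.exists_approx_of_point hy0 hy hlt hsu
    (M := s - φ * T - T + 9 * x) (by linarith) (by linarith) (by linarith)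
  have hfin := (hs₀ _ (by linarith) q p hne hq hp).trans hap
  rw [Real.exp_le_exp] at hfin
  have hδs : δ * (s - φ * T - T + 9 * x + x) ≤ δ * s := by gcongr; linarith
  have h1 : (c + δ) * s - s ≤ -2 * T + 12 * x + δ * s := by linarith
  have h2 : (φ - 1) * ((c + δ) * s) ≤ (φ - 1) * (φ * T + 2 * x) := by gcongr; linarith
  have h3 : (φ - 1) * (φ * T + 2 * x) = T + 2 * (φ * x) - 2 * x := by
    linear_combination T * hsq
  have h4 : (2 * φ - 1) * ((c + δ) * s) = s + (2 * φ - 1) * (δ * s) := by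
    linear_combination s * hc
  have h5 : 2.236 * (δ * s) ≤ (2 * φ - 1) * (δ * s) := by gcongr; linarith
  have h6 : δ * T ≤ δ * s := by gcongr; linarith
  have h7 : 0 < δ * s := by positivity
  linarith

lemma polyH_le {P : ℤ[X]} {M : ℝ} (hM : 0 ≤ M) (h : ∀ i, |(P.coeff i : ℝ)| ≤ M) :
    polyH P ≤ M := by
  rw [polyH, ← Nat.le_floor_iff hM]
  refine Finset.sup_le fun i _ => ?_
  rw [Nat.le_floor_iff hM, Nat.cast_natAbs]
  exact_mod_cast h i

lemma exists_polynomial_of_vec (v : Fin 3 → ℤ) : ∃ P : ℤ[X], P.natDegree ≤ 2 ∧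
    (∀ i : Fin 3, P.coeff i = v i) := by
  refine ⟨C (v 2) * X ^ 2 + C (v 1) * X + C (v 0), natDegree_quadratic_le, fun i => ?_⟩
  fin_cases i <;> simp [coeff_X, -eq_intCast, -map_intCast, coeff_C]

/-- The value of a supremum of exponents, from bounds in logarithmic scale. -/
lemma sSup_eq_of_exp {S : Set ℝ} {c : ℝ} (h1 : ∀ δ, 0 < δ → δ ≤ 1 → c - δ ∈ S)
    (h2 : ∀ δ, 0 < δ → δ ≤ 1 → ∀ η ∈ S, η < c + δ) : sSup S = c := by
  refine IsLUB.csSup_eq ⟨fun η hη => ?_, fun b hb => ?_⟩ ⟨_, h1 1 one_pos le_rfl⟩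
  · refine le_of_forall_pos_lt_add fun δ hδ => ?_
    exact (h2 (min δ 1) (by positivity) (min_le_right _ _) η hη).trans_le
      (by gcongr; exact min_le_left _ _)
  · refine le_of_forall_pos_sub_le fun δ hδ => ?_
    exact le_trans (by gcongr; exact min_le_left _ _)
      (hb (h1 (min δ 1) (by positivity) (min_le_right _ _)))

lemma exp_rpow_neg (s η : ℝ) : Real.exp s ^ (-η) = Real.exp (-(η * s)) := by
  rw [← Real.exp_mul]; ring_nf

lemma wExp_three_lower {ζ : ℝ} (hζ : IsExtremal ζ) {δ : ℝ} (hδ0 : 0 < δ) (hδ1 : δ ≤ 1) :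
    2 * Real.goldenRatio + 1 - δ ∈ wSet 3 ζ := by
  intro X₀
  obtain ⟨Q, t, htri, hbig, -, -⟩ := exists_isGoodSeq_isTriple hζ (ε := δ / 100)
    (by positivity) (by linarith) X₀
  have ht := htri 0
  have hb := hbig 1
  have hpos := ht.pos
  have hsmall := ht.small
  set T := t (0 + 1)
  have hT : 0 < T := by linarith
  obtain ⟨P, hP, hc⟩ := exists_polynomial_of_vec (Q 1)
  have hv : castVec ![P.coeff 0, P.coeff 1, P.coeff 2] = castVec (Q 1) := by
    funext i
    have := hc i
    fin_cases i <;> simpa [castVec] using this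
  have hev : pev ζ P = ev3 ζ (castVec (Q 1)) := by rw [pev_eq_ev3 ζ hP, hv]
  refine ⟨Real.exp T, ?_, P, by omega, polyH_le (by positivity) fun i => ?_, ?_, ?_⟩
  · have := Real.add_one_le_exp T
    change X₀ ≤ δ / 100 * T at hb
    linarith
  · by_cases hi : i < 3
    · exact (hc ⟨i, hi⟩) ▸ ht.coeff_mid ⟨i, hi⟩
    · rw [coeff_eq_zero_of_natDegree_lt (by omega)]
      simpa using Real.exp_nonneg T
  · rw [hev, abs_pos]
    refine ev3_ne_zero hζ.1 fun h0 => ht.res_right ?_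
    change Q 1 = 0 at h0
    change res (Q 1) _ = 0
    rw [h0]; simp [res, det4, det3, low, high]
  · rw [hev, exp_rpow_neg]
    refine ht.ev_mid.trans (Real.exp_le_exp.mpr ?_)
    have : 0 < δ * T := by positivity
    linarith

lemma lt_of_mem_wSet_three {ζ : ℝ} (hζ : IsExtremal ζ) {δ : ℝ} (hδ0 : 0 < δ) (hδ1 : δ ≤ 1)
    {η : ℝ} (hη : η ∈ wSet 3 ζ) : η < 2 * Real.goldenRatio + 1 + δ := by
  by_contra! hlt
  obtain ⟨s₀, hs₀⟩ := cubic_lower_bound hζ hδ0 hδ1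
  obtain ⟨X, hX, P, hdeg, hH, hpos, hle⟩ := hη (Real.exp (max s₀ 0))
  have hX0 : 0 < X := (Real.exp_pos _).trans_le hX
  have hs : max s₀ 0 ≤ Real.log X := (Real.le_log_iff_exp_le hX0).mpr hX
  have hXe := Real.exp_log hX0
  set s := Real.log X
  rw [pev_eq_ev4 ζ hdeg] at hpos hle
  have h := hs₀ s ((le_max_left _ _).trans hs) ![P.coeff 0, P.coeff 1, P.coeff 2, P.coeff 3]
    (fun h0 => by
      rw [h0] at hpos
      simp [ev4, castVec] at hpos)
    (fun i => by
      rw [hXe]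
      fin_cases i <;> exact (abs_coeff_le_polyH P _).trans hH)
  rw [← hXe, exp_rpow_neg] at hle
  have h3 := Real.exp_lt_exp.mp (h.trans_le hle)
  have : (2 * Real.goldenRatio + 1 + δ) * s ≤ η * s := by
    have := (le_max_right _ _).trans hs
    gcongr
  linarith

lemma lt_of_mem_lamSet_three {ζ : ℝ} (hζ : IsExtremal ζ) {c δ : ℝ}
    (hc : c * (2 * Real.goldenRatio - 1) = 1) (hδ0 : 0 < δ) (hδ1 : δ ≤ 1)
    {η : ℝ} (hη : η ∈ lamSet 3 ζ) : η < c + δ := by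
  by_contra! hlt
  obtain ⟨s₀, hs₀⟩ := point_lower_bound hζ hc hδ0 hδ1
  obtain ⟨X, hX, a, b, hne, ha, hle⟩ := hη (Real.exp (max s₀ 0))
  have hX0 : 0 < X := (Real.exp_pos _).trans_le hX
  have hs : max s₀ 0 ≤ Real.log X := (Real.le_log_iff_exp_le hX0).mpr hX
  have hXe := Real.exp_log hX0
  set s := Real.log X
  obtain ⟨i, hi⟩ := hs₀ s ((le_max_left _ _).trans hs) (Fin.cons a b : Fin 4 → ℤ)
    (fun h0 => by
      have h1 : a = 0 := congrFun h0 0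
      have h2 : b = 0 := funext fun i => congrFun h0 i.succ
      tauto)
    (by rw [hXe]; simpa using ha)
  have h0 := (le_max_right _ _).trans hs
  have h1 : Real.exp (-(η * s)) ≤ Real.exp (-((c + δ) * s)) :=
    Real.exp_le_exp.mpr (neg_le_neg (by gcongr))
  rw [← hXe, exp_rpow_neg] at hle
  refine Fin.cases (fun hi => ?_) (fun j hj => ?_) i hi
  · simp at hi
    linarith [Real.exp_pos (-((c + δ) * s))]
  · have := hle j
    simp only [Fin.cons_zero, Fin.cons_succ, Fin.val_succ] at hj
    linarith

lemma lamExp_three_lower {ζ : ℝ} (hζ : IsExtremal ζ) {c δ : ℝ}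
    (hc : c * (2 * Real.goldenRatio - 1) = 1) (hδ0 : 0 < δ) (hδ1 : δ ≤ 1) :
    c - δ ∈ lamSet 3 ζ := by
  intro X₀
  obtain ⟨Q, t, htri, hbig, -, -⟩ := exists_isGoodSeq_isTriple hζ (ε := δ / 100)
    (by positivity) (by linarith) X₀
  have h := htri 0
  have hb := hbig 1
  have hg := goldenRatio_bounds
  have hsq := Real.goldenRatio_sq
  have hx0 := h.pos
  have hxT := h.small
  set T := t (0 + 1)
  set B := Q (0 + 1)
  set D := Q (0 + 2)
  set x := δ / 100 * T with hx
  change X₀ ≤ x at hb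
  obtain ⟨hc1, -⟩ := h.abs_le_exp
  have h24 : 24 ≤ Real.exp x := by linarith [h.const_le.1, abs_nonneg ζ]
  have hT : 0 < T := by linarith
  have hF1 : 1.618 * T ≤ Real.goldenRatio * T := by have := hg.1; gcongr
  have hcF : c * (2 * T + Real.goldenRatio * T) = Real.goldenRatio * T := by
    linear_combination Real.goldenRatio * T * hc - 2 * c * T * hsq
  set F := Real.goldenRatio * T
  have hlB := RowBound.low h.coeff_mid h.ev_mid
  have hhB := RowBound.high h.coeff_mid h.ev_mid hc1
  have hlD := RowBound.low h.coeff_right h.ev_right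
  set y : Fin 4 → ℤ := fun i => det4 (Pi.single i 1) (low B) (high B) (low D) with hy
  have hdet : ∀ w : Fin 4 → ℝ, det4 w (low (castVec B)) (high (castVec B)) (low (castVec D))
      = ∑ i, w i * y i := by
    intro w
    simp [hy, Fin.sum_univ_four, det4, det3, low, high, Pi.single_apply]
    ring
  have hyne : y ≠ 0 := by
    intro h0
    have h1 := hdet (high (castVec D))
    rw [h0, ← castVec_low, ← castVec_low, ← castVec_high, ← castVec_high, ← det4_cast] at h1
    simp only [Pi.zero_apply, Int.cast_zero, mul_zero, Finset.sum_const_zero, Int.cast_eq_zero] at h1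
    have h2 : res B D = -det4 (high D) (low B) (high B) (low D) := by
      simp only [res, det4, det3, Matrix.cons_val]; ring
    exact h.res_right (by rw [h2, h1, neg_zero])
  have hy0 : |(y 0 : ℝ)| ≤ Real.exp (2 * T + F + 2 * x) := by
    have h0 : RowBound ζ (Pi.single 0 1) 0 0 := by
      constructor
      · intro i
        rw [Real.exp_zero]
        fin_cases i <;> simp
      · simp [ev4]
    have h1 := hdet (Pi.single 0 1)
    have h2 := h0.abs_det4_le hlB hhB hlD (M := 2 * T + F + x) (by linarith) (by linarith)
      (by linarith) (by linarith)
    rw [h1] at h2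
    simp only [Fin.sum_univ_four] at h2
    simp at h2
    exact h2.trans ((mul_exp_le h24).trans (Real.exp_le_exp.mpr (by linarith)))
  have hyi : ∀ i : Fin 3, |ζ ^ ((i : ℕ) + 1) * y 0 - y i.succ| ≤ Real.exp (-F + 6 * x) := by
    intro i
    have h0 : RowBound ζ (Pi.single 0 (ζ ^ ((i : ℕ) + 1)) - Pi.single i.succ 1) x (-10 * F) := by
      have h1 : 1 ≤ 1 + |ζ| := by linarith [abs_nonneg ζ]
      have hz : |ζ| ^ ((i : ℕ) + 1) ≤ (1 + |ζ|) ^ 3 := by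
        calc _ ≤ (1 + |ζ|) ^ ((i : ℕ) + 1) := by gcongr; linarith
          _ ≤ _ := by gcongr; omega
      have hz1 : 1 ≤ (1 + |ζ|) ^ 3 := one_le_pow₀ h1
      have hz2 := h.const
      constructor
      · intro j
        have e1 : |(Pi.single 0 (ζ ^ ((i : ℕ) + 1)) : Fin 4 → ℝ) j| ≤ (1 + |ζ|) ^ 3 := by
          rw [Pi.single_apply]
          split_ifs
          · rwa [abs_pow]
          · simpa using by linarith
        have e2 : |(Pi.single i.succ 1 : Fin 4 → ℝ) j| ≤ 1 := by
          rw [Pi.single_apply]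
          split_ifs <;> simp
        rw [Pi.sub_apply]
        refine (abs_sub _ _).trans ?_
        linarith
      · have : ev4 ζ (Pi.single 0 (ζ ^ ((i : ℕ) + 1)) - Pi.single i.succ 1) = 0 := by
          fin_cases i <;> simp [ev4]
        rw [this, abs_zero]
        positivity
    have h1 := hdet (Pi.single 0 (ζ ^ ((i : ℕ) + 1)) - Pi.single i.succ 1)
    have h2 := h0.abs_det4_le hlB hhB hlD (M := -F + 5 * x) (by linarith) (by linarith)
      (by linarith) (by linarith)
    have e : ∑ j, (Pi.single 0 (ζ ^ ((i : ℕ) + 1)) - Pi.single i.succ 1 : Fin 4 → ℝ) j * y j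
        = ζ ^ ((i : ℕ) + 1) * y 0 - y i.succ := by
      simp [sub_mul, Finset.sum_sub_distrib, Pi.single_apply]
    rw [h1, e] at h2
    exact h2.trans ((mul_exp_le h24).trans (Real.exp_le_exp.mpr (by linarith)))
  refine ⟨Real.exp (2 * T + F + 2 * x), ?_, y 0, fun i => y i.succ, ?_, by simpa using hy0,
    fun i => (hyi i).trans ?_⟩
  · have := Real.add_one_le_exp (2 * T + F + 2 * x)
    linarith
  · by_contra! h0
    apply hyne
    funext i
    exact Fin.cases h0.1 (fun j => congrFun h0.2 j) i
  · rw [exp_rpow_neg, Real.exp_le_exp]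
    have hc2 : c ≤ 1 := by nlinarith
    have h1 : c * x ≤ 1 * x := by gcongr
    have h2 : 0 ≤ δ * x := by positivity
    have h3 : 0 ≤ δ * F := by positivity
    linarith

theorem wExp_three {ζ : ℝ} (hζ : IsExtremal ζ) : wExp 3 ζ = 2 * Real.goldenRatio + 1 :=
  sSup_eq_of_exp (fun _ h0 h1 => wExp_three_lower hζ h0 h1)
    fun _ h0 h1 _ hη => lt_of_mem_wSet_three hζ h0 h1 hη

theorem lamExp_three {ζ : ℝ} (hζ : IsExtremal ζ) {c : ℝ}
    (hc : c * (2 * Real.goldenRatio - 1) = 1) : lamExp 3 ζ = c :=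
  sSup_eq_of_exp (fun _ h0 h1 => lamExp_three_lower hζ hc h0 h1)
    fun _ h0 h1 _ hη => lt_of_mem_lamSet_three hζ hc h0 h1 hη

end ExtremalCubic

theorem extremal_w3_lambda3 (ζ : ℝ) (hζ : IsExtremal ζ) :
    wExp 3 ζ = 2 + Real.sqrt 5 ∧ lamExp 3 ζ = 1 / Real.sqrt 5 := by
  have h5 : Real.sqrt 5 ≠ 0 := by positivity
  refine ⟨?_, ExtremalCubic.lamExp_three hζ ?_⟩
  · rw [ExtremalCubic.wExp_three hζ, Real.goldenRatio]; ring
  · rw [Real.goldenRatio]; field_simp; ring
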